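/- arXiv:1705.04611 — 2 statements merged into one kernel-verified Lean document; each statement's English description precedes it below -/
import Mathlib

section
/- Let n ≥ 1, let S′ ⊊ S be subsets of Fin n, and let l, l′ ≥ 1 be integers. Then the idempotent matrix (⊞^l Q_S) ⊞ (⊞^{l′} Q_{S′}) over the Toeplitz algebra T_n is equivalent to ⊞^l Q_S. -/
noncomputable section

/-- `H n` is the Hilbert space `ℓ²(ℕ^n)`. -/
abbrev Hn (n : ℕ) : Type := lp (fun _ : (Fin n → ℕ) => ℂ) 2

/-- the standard basis vector `δ_z`. -/
def delta {n : ℕ} (z : Fin n → ℕ) : Hn n := lp.single 2 z 1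

/-- `T` is the `i`-th coordinate shift: `T δ_z = δ_{z + e_i}`. -/
def IsShift {n : ℕ} (i : Fin n) (T : Hn n →L[ℂ] Hn n) : Prop :=
  ∀ z : Fin n → ℕ, T (delta z) = delta (Function.update z i (z i + 1))

/-- The Toeplitz algebra `T_n`: the smallest norm-closed star-subalgebra of `B(H_n)`
containing the coordinate shifts. -/
def Toeplitz (n : ℕ) : StarSubalgebra ℂ (Hn n →L[ℂ] Hn n) :=
  (StarAlgebra.adjoin ℂ {T : Hn n →L[ℂ] Hn n | ∃ i : Fin n, IsShift i T}).topologicalClosure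

open scoped Classical in
/-- `Q` is the orthogonal projection onto the closed span of `{δ_z : z_i = 0 for all i ∉ S}`,
characterized by its action on the orthonormal basis. -/
def IsQProj {n : ℕ} (S : Finset (Fin n)) (Q : Hn n →L[ℂ] Hn n) : Prop :=
  ∀ z : Fin n → ℕ, Q (delta z) = if ∀ i ∉ S, z i = 0 then delta z else 0

/-- Padding a matrix by zeros into an `N × N` matrix along an embedding `f`. -/
def padMat {R : Type*} [Semiring R] {ι : Type*} [Fintype ι] {N : ℕ}
    (f : ι ↪ Fin N) (P : Matrix ι ι R) : Matrix (Fin N) (Fin N) R :=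
  fun i j => ∑ a : ι, ∑ b : ι, if f a = i ∧ f b = j then P a b else 0

/-- Equivalence of (idempotent) matrices over a ring `R`: after enlarging by zero diagonal blocks
to a common size `N`, they are conjugate by an invertible `N × N` matrix. -/
def IdemEquiv {R : Type*} [Ring R] {ι κ : Type*} [Fintype ι] [Fintype κ]
    (P : Matrix ι ι R) (Q : Matrix κ κ R) : Prop :=
  ∃ (N : ℕ) (f : ι ↪ Fin N) (g : κ ↪ Fin N) (U : (Matrix (Fin N) (Fin N) R)ˣ),
    U.val * padMat f P * (U⁻¹).val = padMat g Q

section Idempotents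

variable {R : Type*} [Ring R]

lemma padMat_eq_reindex_left {ι κ : Type*} [Fintype ι] [Fintype κ] {N : ℕ}
    (φ : ι ⊕ κ ≃ Fin N) (P : Matrix ι ι R) :
    padMat (Function.Embedding.inl.trans φ.toEmbedding) P =
      (Matrix.fromBlocks P 0 0 (0 : Matrix κ κ R)).submatrix φ.symm φ.symm := by
  classical
  ext i j
  obtain ⟨i, rfl⟩ := φ.surjective i
  obtain ⟨j, rfl⟩ := φ.surjective j
  rcases i with i | i <;> rcases j with j | j <;>
    simp [padMat, ite_and]

lemma padMat_eq_reindex_right {ι κ : Type*} [Fintype ι] [Fintype κ] {N : ℕ}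
    (φ : ι ⊕ κ ≃ Fin N) (Q : Matrix κ κ R) :
    padMat (Function.Embedding.inr.trans φ.toEmbedding) Q =
      (Matrix.fromBlocks (0 : Matrix ι ι R) 0 0 Q).submatrix φ.symm φ.symm := by
  classical
  ext i j
  obtain ⟨i, rfl⟩ := φ.surjective i
  obtain ⟨j, rfl⟩ := φ.surjective j
  rcases i with i | i <;> rcases j with j | j <;>
    simp [padMat, ite_and]

/-- Murray–von Neumann equivalent idempotents `A * B` and `B * A` are stably conjugate. -/
lemma IdemEquiv.of_mul_eq {ι κ : Type*} [Fintype ι] [Fintype κ]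
    {P : Matrix ι ι R} {Q : Matrix κ κ R} (A : Matrix ι κ R) (B : Matrix κ ι R)
    (hAB : A * B = P) (hBA : B * A = Q) (hPA : P * A = A) (hBP : B * P = B) :
    IdemEquiv P Q := by
  classical
  have hAQ : A * Q = A := by rw [← hBA, ← Matrix.mul_assoc, hAB, hPA]
  have hQB : Q * B = B := by rw [← hBA, Matrix.mul_assoc, hAB, hBP]
  let φ : ι ⊕ κ ≃ Fin (Fintype.card (ι ⊕ κ)) := Fintype.equivFin _
  let V : Matrix (ι ⊕ κ) (ι ⊕ κ) R := Matrix.fromBlocks (1 - P) A B (1 - Q)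
  have hPP : P * P = P := by
    nth_rw 2 [← hAB]
    rw [← Matrix.mul_assoc, hPA, hAB]
  have hQQ : Q * Q = Q := by
    nth_rw 2 [← hBA]
    rw [← Matrix.mul_assoc, hQB, hBA]
  have hVV : V * V = 1 := by
    simp [V, Matrix.fromBlocks_multiply, Matrix.mul_sub, Matrix.sub_mul, hAB, hBA, hPA, hBP, hAQ,
      hQB, hPP, hQQ]
  have hU : V.submatrix φ.symm φ.symm * V.submatrix φ.symm φ.symm = 1 := by
    rw [Matrix.submatrix_mul_equiv, hVV, Matrix.submatrix_one_equiv]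
  refine ⟨_, Function.Embedding.inl.trans φ.toEmbedding,
    Function.Embedding.inr.trans φ.toEmbedding, ⟨_, _, hU, hU⟩, ?_⟩
  rw [padMat_eq_reindex_left, padMat_eq_reindex_right]
  simp only [Units.inv_mk, Matrix.submatrix_mul_equiv]
  simp [V, Matrix.fromBlocks_multiply, Matrix.mul_sub, Matrix.sub_mul, hBA, hBP, hPP]

/-- If `W` is an isometry commuting with the idempotent `E` and with range complement
`F ≤ E`, then copies of `F` are absorbed by a nonempty diagonal sum of copies of `E`. -/
lemma IdemEquiv.absorb {E F W W' : R} (hW : W' * W = 1) (hF : W * W' = 1 - F)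
    (hE : E * E = E) (hEF : E * F = F)
    (hEW : Commute E W) {l : ℕ} (hl : 1 ≤ l) (l' : ℕ) :
    IdemEquiv
      (Matrix.fromBlocks (Matrix.diagonal fun _ : Fin l => E) 0 0
        (Matrix.diagonal fun _ : Fin l' => F))
      (Matrix.diagonal fun _ : Fin l => E) := by
  have hFeq : F = 1 - W * W' := by rw [hF]; abel
  have hFW : F * W = 0 := by rw [hFeq, sub_mul, mul_assoc, hW]; simp
  have hWF : W' * F = 0 := by rw [hFeq, mul_sub, ← mul_assoc, hW]; simp
  have hFF : F * F = F := by nth_rw 2 [hFeq]; rw [mul_sub, ← mul_assoc, hFW]; simp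
  have hpow (k : ℕ) : W' ^ k * W ^ k = 1 := by
    induction k with
    | zero => simp
    | succ k ih => rw [pow_succ W', pow_succ' W, mul_assoc, ← mul_assoc W', hW, one_mul, ih]
  have hlt (j m : ℕ) : W' ^ j * W ^ (j + m) = W ^ m := by
    rw [pow_add, ← mul_assoc, hpow, one_mul]
  have hgt (j m : ℕ) : W' ^ (j + m) * W ^ j = W' ^ m := by
    rw [add_comm, pow_add, mul_assoc, hpow, mul_one]
  have hFWpow (m : ℕ) : F * W ^ (m + 1) = 0 := by rw [pow_succ', ← mul_assoc, hFW, zero_mul]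
  have hWFpow (m : ℕ) : W' ^ (m + 1) * F = 0 := by rw [pow_succ, mul_assoc, hWF, mul_zero]
  have htel (k : ℕ) : ∑ j ∈ Finset.range k, W ^ j * F * W' ^ j = 1 - W ^ k * W' ^ k := by
    induction k with
    | zero => simp
    | succ k ih =>
      rw [Finset.sum_range_succ, ih, hFeq, pow_succ W, pow_succ' W']
      noncomm_ring
  have horth (j k : ℕ) : F * W' ^ j * (W ^ k * F) = if j = k then F else 0 := by
    rw [mul_assoc, ← mul_assoc (W' ^ j)]
    rcases lt_trichotomy j k with h | rfl | h
    · obtain ⟨m, rfl⟩ := Nat.exists_eq_add_of_lt h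
      rw [add_assoc, hlt, ← mul_assoc, hFWpow, zero_mul, if_neg (by omega)]
    · rw [hpow, one_mul, hFF, if_pos rfl]
    · obtain ⟨m, rfl⟩ := Nat.exists_eq_add_of_lt h
      rw [add_assoc, hgt, hWFpow, mul_zero, if_neg (by omega)]
  let o : Fin l := ⟨0, hl⟩
  let A₁ : Matrix (Fin l) (Fin l) R :=
    Matrix.diagonal fun a => if a = o then E * W' ^ l' else E
  let A₂ : Matrix (Fin l') (Fin l) R :=
    Matrix.of fun k b => if b = o then F * W' ^ (k : ℕ) else 0
  let B₁ : Matrix (Fin l) (Fin l) R :=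
    Matrix.diagonal fun a => if a = o then W ^ l' * E else E
  let B₂ : Matrix (Fin l) (Fin l') R :=
    Matrix.of fun a k => if a = o then W ^ (k : ℕ) * F else 0
  have h11 : A₁ * B₁ = Matrix.diagonal fun _ => E := by
    simp only [A₁, B₁, Matrix.diagonal_mul_diagonal]
    congr 1
    ext a
    split_ifs
    · rw [mul_assoc, ← mul_assoc (W' ^ l'), hpow, one_mul, hE]
    · exact hE
  have h12 : A₁ * B₂ = 0 := by
    ext a k
    simp only [A₁, B₂, Matrix.diagonal_mul, Matrix.of_apply, Matrix.zero_apply]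
    split_ifs
    · obtain ⟨m, hm⟩ := Nat.exists_eq_add_of_lt k.2
      rw [mul_assoc, ← mul_assoc (W' ^ _), show W' ^ l' = W' ^ (k + (m + 1)) from
        congrArg _ hm, hgt, hWFpow, mul_zero]
    · simp
  have h21 : A₂ * B₁ = 0 := by
    ext k a
    simp only [A₂, B₁, Matrix.mul_diagonal, Matrix.of_apply, Matrix.zero_apply]
    split_ifs
    · obtain ⟨m, hm⟩ := Nat.exists_eq_add_of_lt k.2
      rw [mul_assoc, ← mul_assoc (W' ^ _), show W ^ l' = W ^ (k + (m + 1)) from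
        congrArg _ hm, hlt, ← mul_assoc, hFWpow, zero_mul]
    · simp
  have h22 : A₂ * B₂ = Matrix.diagonal fun _ => F := by
    ext j k
    simp only [A₂, B₂, Matrix.mul_apply, Matrix.of_apply, ite_mul, zero_mul, mul_ite, mul_zero]
    simp only [horth, Matrix.diagonal_apply, Finset.sum_ite_eq', Finset.mem_univ, if_true,
      Fin.val_inj]
  have hBA : B₁ * A₁ + B₂ * A₂ = Matrix.diagonal fun _ => E := by
    have hsum : W ^ l' * E * (E * W' ^ l') + ∑ k : Fin l', W ^ (k : ℕ) * F * (F * W' ^ (k : ℕ))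
        = E := by
      have hk (k : ℕ) : W ^ k * F * (F * W' ^ k) = E * (W ^ k * F * W' ^ k) := by
        rw [mul_assoc, ← mul_assoc F, hFF, ← mul_assoc E, ← mul_assoc E,
          (hEW.pow_right k).eq, mul_assoc (W ^ k) E F, hEF, mul_assoc]
      simp only [hk, ← Finset.mul_sum]
      rw [Fin.sum_univ_eq_sum_range (fun k => W ^ k * F * W' ^ k), htel, mul_assoc,
        ← mul_assoc E E, hE, ← mul_assoc (W ^ l'), ← (hEW.pow_right l').eq]
      noncomm_ring
    ext a b
    simp only [A₁, A₂, B₁, B₂, Matrix.add_apply, Matrix.diagonal_mul_diagonal, Matrix.mul_apply,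
      Matrix.of_apply, Matrix.diagonal_apply]
    by_cases hab : a = b
    · subst hab
      by_cases ha : a = o
      · simpa [ha] using hsum
      · simp [ha, hE]
    · by_cases ha : a = o
      · have hb : b ≠ o := fun hb => hab (ha.trans hb.symm)
        simp [hab, hb]
      · simp [hab, ha]
  have hEd : (Matrix.diagonal fun _ : Fin l => E) * A₁ = A₁ := by
    simp only [A₁, Matrix.diagonal_mul_diagonal]
    congr 1
    ext a
    split_ifs
    · rw [← mul_assoc, hE]
    · exact hE
  have hFd : (Matrix.diagonal fun _ : Fin l' => F) * A₂ = A₂ := by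
    ext k a
    simp [A₂, ← mul_assoc, hFF]
  have hEd' : B₁ * (Matrix.diagonal fun _ : Fin l => E) = B₁ := by
    simp only [B₁, Matrix.diagonal_mul_diagonal]
    congr 1
    ext a
    split_ifs
    · rw [mul_assoc, hE]
    · exact hE
  have hFd' : B₂ * (Matrix.diagonal fun _ : Fin l' => F) = B₂ := by
    ext k a
    simp [B₂, mul_assoc, hFF]
  refine IdemEquiv.of_mul_eq (Matrix.fromRows A₁ A₂) (Matrix.fromCols B₁ B₂) ?_ ?_ ?_ ?_
  · rw [Matrix.fromRows_mul_fromCols, h11, h12, h21, h22]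
  · rw [Matrix.fromCols_mul_fromRows, hBA]
  · rw [Matrix.fromBlocks_mul_fromRows]
    simp [hEd, hFd]
  · rw [Matrix.fromCols_mul_fromBlocks]
    simp [hEd', hFd']

/-- Absorption for `F = G (1 - s t)`, where `s` is an isometry with left inverse `t` and `G ≤ E` is
an idempotent commuting with both; the isometry with range complement `F` is `1 - G + s G`. -/
lemma IdemEquiv.absorb_of_shift {E F G s t : R} (hts : t * s = 1) (hGs : G * s = s * G)
    (hGt : G * t = t * G) (hG : G * G = G) (hE : E * E = E) (hEG : E * G = G) (hGE : G * E = G)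
    (hF : F = G * (1 - s * t)) {l : ℕ} (hl : 1 ≤ l) (l' : ℕ) :
    IdemEquiv
      (Matrix.fromBlocks (Matrix.diagonal fun _ : Fin l => E) 0 0
        (Matrix.diagonal fun _ : Fin l' => F))
      (Matrix.diagonal fun _ : Fin l => E) := by
  have hcomm_s : Commute E (s * G) := by
    change E * (s * G) = s * G * E
    rw [mul_assoc, hGE, ← hGs, ← mul_assoc, hEG]
  have hcomm_G : Commute E G := hEG.trans hGE.symm
  have hsG : (1 - G) * (s * G) = 0 := by
    rw [← hGs, ← mul_assoc, sub_mul, hG, one_mul, sub_self, zero_mul]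
  have htG : G * t * (1 - G) = 0 := by
    rw [hGt, mul_assoc, mul_sub, hG, mul_one, sub_self, mul_zero]
  have hcG : (1 - G) * (1 - G) = 1 - G := by
    rw [mul_sub, mul_one, sub_mul, hG, one_mul, sub_self, sub_zero]
  refine IdemEquiv.absorb (W := 1 - G + s * G) (W' := 1 - G + G * t) ?_ ?_ hE ?_
    (((Commute.one_right E).sub_right hcomm_G).add_right hcomm_s) hl l'
  · have : G * t * (s * G) = G := by rw [mul_assoc, ← mul_assoc t, hts, one_mul, hG]
    rw [mul_add, add_mul, add_mul, hcG, htG, hsG, this]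
    abel
  · have h1 : (1 - G) * (G * t) = 0 := by
      rw [← mul_assoc, sub_mul, hG, one_mul, sub_self, zero_mul]
    have h2 : s * G * (1 - G) = 0 := by
      rw [mul_assoc, mul_sub, hG, mul_one, sub_self, mul_zero]
    have h3 : s * G * (G * t) = G * (s * t) := by
      rw [mul_assoc, ← mul_assoc G, hG, ← mul_assoc, ← hGs, mul_assoc]
    rw [mul_add, add_mul, add_mul, hcG, h1, h2, h3, hF]
    noncomm_ring
  · rw [hF, ← mul_assoc, hEG]

end Idempotents

section Operators

variable {n : ℕ}

lemma clm_ext_delta {A B : Hn n →L[ℂ] Hn n} (h : ∀ z, A (delta z) = B (delta z)) : A = B := by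
  refine lp.ext_continuousLinearMap (by norm_num) fun z => ?_
  refine ContinuousLinearMap.ext_ring ?_
  simpa [delta] using h z

lemma inner_delta (z : Fin n → ℕ) (x : Hn n) : inner ℂ (delta z) x = x z := by
  simp [delta, lp.inner_single_left]

lemma delta_apply (z w : Fin n → ℕ) : (delta z : Hn n) w = if w = z then 1 else 0 := by
  simp [delta, Pi.single_apply]

lemma orthonormal_delta : Orthonormal ℂ (delta : (Fin n → ℕ) → Hn n) := by
  classical
  rw [orthonormal_iff_ite]
  intro z w
  rw [inner_delta, delta_apply]

lemma update_succ_injective (i : Fin n) :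
    Function.Injective fun z : Fin n → ℕ => Function.update z i (z i + 1) := by
  intro z w h
  ext j
  have := congrFun h j
  by_cases hj : j = i
  · subst hj
    simpa using this
  · simpa [hj] using this

lemma exists_isShift (i : Fin n) :
    ∃ T : Hn n →L[ℂ] Hn n, IsShift i T ∧ star T * T = 1 := by
  have hv := (orthonormal_delta (n := n)).comp _ (update_succ_injective i)
  refine ⟨hv.orthogonalFamily.linearIsometry.toContinuousLinearMap, fun z => ?_, ?_⟩
  · simp [delta]
  · exact (ContinuousLinearMap.norm_map_iff_adjoint_comp_self _).1
      hv.orthogonalFamily.linearIsometry.norm_map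

lemma IsShift.mem_toeplitz {i : Fin n} {T : Hn n →L[ℂ] Hn n} (h : IsShift i T) :
    T ∈ Toeplitz n :=
  StarSubalgebra.le_topologicalClosure _ (StarAlgebra.subset_adjoin ℂ _ ⟨i, h⟩)

lemma IsShift.star_apply_of_eq_zero {i : Fin n} {T : Hn n →L[ℂ] Hn n} (h : IsShift i T)
    {z : Fin n → ℕ} (hz : z i = 0) : star T (delta z) = 0 := by
  ext w
  rw [← inner_delta, ContinuousLinearMap.star_eq_adjoint,
    ContinuousLinearMap.adjoint_inner_right, h, inner_delta, delta_apply, if_neg]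
  · rfl
  · rintro rfl
    simp at hz

/-- Every basis vector either has vanishing `i`-th coordinate or is an `i`-shift. -/
lemma eq_zero_or_eq_update (i : Fin n) (z : Fin n → ℕ) :
    z i = 0 ∨ ∃ w : Fin n → ℕ, z = Function.update w i (w i + 1) := by
  rcases Nat.eq_zero_or_pos (z i) with h | h
  · exact Or.inl h
  · refine Or.inr ⟨Function.update z i (z i - 1), ?_⟩
    simp [Nat.sub_add_cancel h]

lemma IsShift.star_apply_update {i : Fin n} {T : Hn n →L[ℂ] Hn n} (h : IsShift i T)
    (hT : star T * T = 1) (z : Fin n → ℕ) :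
    star T (delta (Function.update z i (z i + 1))) = delta z := by
  rw [← h z]
  exact DFunLike.congr_fun hT (delta z)

/-- Multiplying `Q_S` by `1 - S_i S_i*` gives `Q_{S \ {i}}`. -/
lemma IsQProj.mul_one_sub {S : Finset (Fin n)} {Q T : Hn n →L[ℂ] Hn n} {i : Fin n}
    (hQ : IsQProj S Q) (h : IsShift i T) (hT : star T * T = 1) :
    IsQProj (S.erase i) (Q * (1 - T * star T)) := by
  intro z
  rcases eq_zero_or_eq_update i z with hz | ⟨w, rfl⟩
  · have : (∀ j ∉ S.erase i, z j = 0) ↔ ∀ j ∉ S, z j = 0 := by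
      refine ⟨fun H j hj => H j fun hj' => hj (Finset.mem_of_mem_erase hj'), fun H j hj => ?_⟩
      by_cases hji : j = i
      · rw [hji, hz]
      · exact H j fun hj' => hj (Finset.mem_erase.2 ⟨hji, hj'⟩)
    simp only [this, ← hQ z]
    simp [h.star_apply_of_eq_zero hz]
  · rw [if_neg]
    · simp [h.star_apply_update hT, h w]
    · intro H
      simpa using H i (by simp)

lemma IsQProj.unique {S : Finset (Fin n)} {Q Q' : Hn n →L[ℂ] Hn n}
    (hQ : IsQProj S Q) (hQ' : IsQProj S Q') : Q = Q' :=
  clm_ext_delta fun z => (hQ z).trans (hQ' z).symm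

lemma exists_isQProj_mem_toeplitz (S : Finset (Fin n)) :
    ∃ Q ∈ Toeplitz n, IsQProj S Q := by
  suffices ∀ U : Finset (Fin n), ∃ Q ∈ Toeplitz n, IsQProj Uᶜ Q by simpa using this Sᶜ
  intro U
  induction U using Finset.induction_on with
  | empty => exact ⟨1, one_mem _, fun z => by simp⟩
  | insert i U _ ih =>
    obtain ⟨Q, hmem, hQ⟩ := ih
    obtain ⟨T, h, hT⟩ := exists_isShift i
    refine ⟨Q * (1 - T * star T), mul_mem hmem (sub_mem (one_mem _)
      (mul_mem h.mem_toeplitz (star_mem h.mem_toeplitz))), ?_⟩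
    rw [Finset.compl_insert]
    exact hQ.mul_one_sub h hT

lemma IsQProj.mul_of_subset {S T : Finset (Fin n)} {P Q : Hn n →L[ℂ] Hn n}
    (hP : IsQProj S P) (hQ : IsQProj T Q) (hST : S ⊆ T) : Q * P = P := by
  refine clm_ext_delta fun z => ?_
  rw [mul_apply_eq_comp, hP z]
  split_ifs with hz
  · rw [hQ z, if_pos fun i hi => hz i fun hi' => hi (hST hi')]
  · simp

lemma IsQProj.mul_of_subset' {S T : Finset (Fin n)} {P Q : Hn n →L[ℂ] Hn n}
    (hP : IsQProj S P) (hQ : IsQProj T Q) (hST : S ⊆ T) : P * Q = P := by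
  refine clm_ext_delta fun z => ?_
  rw [mul_apply_eq_comp, hQ z]
  split_ifs with hz
  · rfl
  · rw [hP z, if_neg fun H => hz fun i hi => H i fun hi' => hi (hST hi'), map_zero]

lemma forall_update_eq_zero_iff {S : Finset (Fin n)} {i : Fin n} (hi : i ∈ S) (z : Fin n → ℕ)
    (a : ℕ) : (∀ j ∉ S, Function.update z i a j = 0) ↔ ∀ j ∉ S, z j = 0 := by
  refine forall₂_congr fun j hj => ?_
  rw [Function.update_of_ne (ne_of_mem_of_not_mem hi hj).symm]

lemma IsQProj.mul_shift {S : Finset (Fin n)} {Q T : Hn n →L[ℂ] Hn n} {i : Fin n}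
    (hQ : IsQProj S Q) (h : IsShift i T) (hi : i ∈ S) : Q * T = T * Q := by
  refine clm_ext_delta fun z => ?_
  rw [mul_apply_eq_comp, mul_apply_eq_comp, h z, hQ, hQ z]
  simp only [forall_update_eq_zero_iff hi]
  split_ifs
  · rw [h z]
  · simp

lemma IsQProj.mul_star_shift {S : Finset (Fin n)} {Q T : Hn n →L[ℂ] Hn n} {i : Fin n}
    (hQ : IsQProj S Q) (h : IsShift i T) (hT : star T * T = 1) (hi : i ∈ S) :
    Q * star T = star T * Q := by
  refine clm_ext_delta fun z => ?_
  rw [mul_apply_eq_comp, mul_apply_eq_comp, hQ z]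
  rcases eq_zero_or_eq_update i z with hz | ⟨w, rfl⟩
  · split_ifs <;> simp [h.star_apply_of_eq_zero hz]
  · simp only [forall_update_eq_zero_iff hi]
    rw [h.star_apply_update hT, hQ w]
    split_ifs
    · rw [h.star_apply_update hT]
    · simp

end Operators

theorem stmt0 (n : ℕ) (hn : 1 ≤ n) (S S' : Finset (Fin n)) (hss : S' ⊂ S)
    (l l' : ℕ) (hl : 1 ≤ l) (hl' : 1 ≤ l')
    (QS QS' : Hn n →L[ℂ] Hn n) (hQS : IsQProj S QS) (hQS' : IsQProj S' QS')
    (hmem : QS ∈ Toeplitz n) (hmem' : QS' ∈ Toeplitz n) :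
    IdemEquiv
      (Matrix.fromBlocks
        (Matrix.diagonal fun _ : Fin l => (⟨QS, hmem⟩ : Toeplitz n))
        0 0
        (Matrix.diagonal fun _ : Fin l' => (⟨QS', hmem'⟩ : Toeplitz n)))
      (Matrix.diagonal fun _ : Fin l => (⟨QS, hmem⟩ : Toeplitz n)) := by
  obtain ⟨i, hiS, hiS'⟩ := Finset.exists_of_ssubset hss
  obtain ⟨T, h, hT⟩ := exists_isShift i
  obtain ⟨G, hGmem, hG⟩ := exists_isQProj_mem_toeplitz (insert i S')
  have hi : i ∈ insert i S' := Finset.mem_insert_self i S'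
  have hGS : insert i S' ⊆ S := Finset.insert_subset hiS hss.1
  have hF : QS' = G * (1 - T * star T) := by
    refine hQS'.unique ?_
    simpa [Finset.erase_insert hiS'] using hG.mul_one_sub h hT
  exact IdemEquiv.absorb_of_shift (G := ⟨G, hGmem⟩) (s := ⟨T, h.mem_toeplitz⟩)
    (t := ⟨star T, star_mem h.mem_toeplitz⟩)
    (Subtype.ext hT) (Subtype.ext (hG.mul_shift h hi)) (Subtype.ext (hG.mul_star_shift h hT hi))
    (Subtype.ext (hG.mul_of_subset hG subset_rfl)) (Subtype.ext (hQS.mul_of_subset hQS subset_rfl))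
    (Subtype.ext (hG.mul_of_subset hQS hGS)) (Subtype.ext (hG.mul_of_subset' hQS hGS))
    (Subtype.ext hF) hl l'
end
end

section
/- Let T := T_1 be the Toeplitz algebra generated by the unilateral shift S on ℓ²(ℕ), and let q := 1 − S S* (the orthogonal projection onto ℂδ_0). Every idempotent matrix over T is equivalent to exactly one matrix from the list consisting of ⊞^l q for l ≥ 0 (with ⊞^0 q the zero 1×1 matrix) and ⊞^m 1 for m ≥ 1; in particular, these listed matrices are pairwise inequivalent over T. -/
noncomputable section

/-- `ℓ²(ℕ)`. -/
abbrev H1 : Type := lp (fun _ : ℕ => ℂ) 2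

/-- the standard basis vector `δ_j`. -/
def delta1 (j : ℕ) : H1 := lp.single 2 j 1

/-- `T` is the unilateral shift: `T δ_j = δ_{j+1}`. -/
def IsShift1 (T : H1 →L[ℂ] H1) : Prop := ∀ j : ℕ, T (delta1 j) = delta1 (j + 1)

/-- The Toeplitz algebra `T_1`: the smallest norm-closed star-subalgebra of `B(ℓ²(ℕ))`
containing the unilateral shift. -/
def Toeplitz1 : StarSubalgebra ℂ (H1 →L[ℂ] H1) :=
  (StarAlgebra.adjoin ℂ {T : H1 →L[ℂ] H1 | IsShift1 T}).topologicalClosure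

/-- The size of the `c`-th matrix in the canonical list: `Sum.inl l` stands for `⊞^l q`
(size `l`, any `l ≥ 0`) and `Sum.inr m` stands for `⊞^{m+1} 1` (size `m + 1`). -/
def canonSize : ℕ ⊕ ℕ → ℕ
  | Sum.inl L => L
  | Sum.inr m => m + 1

/-- The canonical list of idempotent matrices over `R` built from an element `q`:
`⊞^l q` for `l ≥ 0` and the identity matrices `⊞^m 1` for `m ≥ 1`. -/
def canonMat {R : Type*} [Ring R] (q : R) :
    (c : ℕ ⊕ ℕ) → Matrix (Fin (canonSize c)) (Fin (canonSize c)) R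
  | Sum.inl L => Matrix.diagonal fun _ : Fin L => q
  | Sum.inr m => Matrix.diagonal fun _ : Fin (m + 1) => 1

/-- Algebraic Murray–von Neumann equivalence of square matrices over a ring. -/
def MvN {R : Type*} [Ring R] {ι κ : Type*} [Fintype ι] [Fintype κ]
    (P : Matrix ι ι R) (Q : Matrix κ κ R) : Prop :=
  ∃ (X : Matrix ι κ R) (Y : Matrix κ ι R), X * Y = P ∧ Y * X = Q

section MvN

open Matrix

variable {R : Type*} [Ring R] {ι κ μ ν : Type*} [Fintype ι] [Fintype κ] [Fintype μ] [Fintype ν]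

theorem MvN.symm {P : Matrix ι ι R} {Q : Matrix κ κ R} (h : MvN P Q) : MvN Q P := by
  obtain ⟨X, Y, h₁, h₂⟩ := h
  exact ⟨Y, X, h₂, h₁⟩

theorem MvN.trans {P : Matrix ι ι R} {Q : Matrix κ κ R} {M : Matrix μ μ R}
    (hP : P * P = P) (hM : M * M = M) (h : MvN P Q) (h' : MvN Q M) : MvN P M := by
  obtain ⟨X, Y, h₁, h₂⟩ := h
  obtain ⟨Z, W, h₃, h₄⟩ := h'
  refine ⟨X * Z, W * Y, ?_, ?_⟩
  · calc X * Z * (W * Y) = X * (Z * W) * Y := by simp only [Matrix.mul_assoc]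
      _ = (X * Y) * (X * Y) := by rw [h₃, ← h₂]; simp only [Matrix.mul_assoc]
      _ = P := by rw [h₁, hP]
  · calc W * Y * (X * Z) = W * (Y * X) * Z := by simp only [Matrix.mul_assoc]
      _ = (W * Z) * (W * Z) := by rw [h₂, ← h₃]; simp only [Matrix.mul_assoc]
      _ = M := by rw [h₄, hM]

theorem MvN.fromBlocks {P : Matrix ι ι R} {Q : Matrix κ κ R} {P' : Matrix μ μ R}
    {Q' : Matrix ν ν R} (h : MvN P P') (h' : MvN Q Q') :
    MvN (fromBlocks P 0 0 Q) (fromBlocks P' 0 0 Q') := by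
  obtain ⟨X, Y, rfl, rfl⟩ := h
  obtain ⟨Z, W, rfl, rfl⟩ := h'
  exact ⟨Matrix.fromBlocks X 0 0 Z, Matrix.fromBlocks Y 0 0 W, by simp [fromBlocks_multiply],
    by simp [fromBlocks_multiply]⟩

/-- A sum of two orthogonal idempotents is equivalent to their diagonal sum. -/
theorem mvn_add_fromBlocks {E F : Matrix ι ι R} (hE : E * E = E) (hF : F * F = F)
    (hEF : E * F = 0) (hFE : F * E = 0) : MvN (E + F) (fromBlocks E 0 0 F) := by
  refine ⟨fromCols E F, fromRows E F, ?_, ?_⟩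
  · rw [fromCols_mul_fromRows, hE, hF]
  · rw [fromRows_mul_fromCols, hE, hF, hEF, hFE]

theorem padMat_apply_apply {N : ℕ} (f : ι ↪ Fin N) (P : Matrix ι ι R) (a b : ι) :
    padMat f P (f a) (f b) = P a b := by
  classical
  simp only [padMat, f.injective.eq_iff, ite_and]
  simp

theorem padMat_of_notMem_left {N : ℕ} (f : ι ↪ Fin N) (P : Matrix ι ι R) {i : Fin N}
    (hi : ∀ a, f a ≠ i) (j : Fin N) : padMat f P i j = 0 := by
  simp [padMat, hi]

theorem padMat_of_notMem_right {N : ℕ} (f : ι ↪ Fin N) (P : Matrix ι ι R) (i : Fin N) {j : Fin N}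
    (hj : ∀ a, f a ≠ j) : padMat f P i j = 0 := by
  simp [padMat, hj]

theorem padMat_inl {κ : Type*} {N : ℕ} (e : ι ⊕ κ ≃ Fin N) (P : Matrix ι ι R) :
    padMat (Function.Embedding.inl.trans e.toEmbedding) P =
      reindex e e (fromBlocks P 0 0 (0 : Matrix κ κ R)) := by
  ext i j
  obtain ⟨i, rfl⟩ := e.surjective i
  obtain ⟨j, rfl⟩ := e.surjective j
  rcases i with i | i
  · rcases j with j | j
    · simpa using padMat_apply_apply (Function.Embedding.inl.trans e.toEmbedding) P i j
    · rw [padMat_of_notMem_right _ _ _ (by simp)]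
      simp
  · rw [padMat_of_notMem_left _ _ (by simp)]
    rcases j with j | j <;> simp

theorem padMat_inr {ι : Type*} {N : ℕ} (e : ι ⊕ κ ≃ Fin N) (Q : Matrix κ κ R) :
    padMat (Function.Embedding.inr.trans e.toEmbedding) Q =
      reindex e e (fromBlocks (0 : Matrix ι ι R) 0 0 Q) := by
  ext i j
  obtain ⟨i, rfl⟩ := e.surjective i
  obtain ⟨j, rfl⟩ := e.surjective j
  rcases i with i | i
  · rw [padMat_of_notMem_left _ _ (by simp)]
    rcases j with j | j <;> simp
  · rcases j with j | j
    · rw [padMat_of_notMem_right _ _ _ (by simp)]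
      simp
    · simpa using padMat_apply_apply (Function.Embedding.inr.trans e.toEmbedding) Q i j

theorem MvN.idemEquiv {P : Matrix ι ι R} {Q : Matrix κ κ R} (hP : P * P = P) (hQ : Q * Q = Q)
    (h : MvN P Q) : IdemEquiv P Q := by
  classical
  obtain ⟨X, Y, hXY, hYX⟩ := h
  let X' := P * X * Q
  let Y' := Q * Y * P
  have hXY' : X' * Y' = P := by
    calc X' * Y' = P * X * (Q * Q) * Y * P := by simp only [X', Y', Matrix.mul_assoc]
      _ = P * ((X * Y) * (X * Y)) * P := by rw [hQ, ← hYX]; simp only [Matrix.mul_assoc]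
      _ = P := by rw [hXY, hP, hP, hP]
  have hYX' : Y' * X' = Q := by
    calc Y' * X' = Q * Y * (P * P) * X * Q := by simp only [X', Y', Matrix.mul_assoc]
      _ = Q * ((Y * X) * (Y * X)) * Q := by rw [hP, ← hXY]; simp only [Matrix.mul_assoc]
      _ = Q := by rw [hYX, hQ, hQ, hQ]
  have hPX : P * X' = X' := by simp only [X', ← Matrix.mul_assoc, hP]
  have hXQ : X' * Q = X' := by simp only [X', Matrix.mul_assoc, hQ]
  have hQY : Q * Y' = Y' := by simp only [Y', ← Matrix.mul_assoc, hQ]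
  have hYP : Y' * P = Y' := by simp only [Y', Matrix.mul_assoc, hP]
  let U : Matrix (ι ⊕ κ) (ι ⊕ κ) R := Matrix.fromBlocks (1 - P) X' Y' (1 - Q)
  have hUU : U * U = 1 := by
    rw [← fromBlocks_one]
    simp only [U, fromBlocks_multiply, hXY', hYX', Matrix.sub_mul, Matrix.mul_sub, hPX, hXQ, hQY,
      hYP, hP, hQ, Matrix.one_mul, Matrix.mul_one]
    simp
  have hconj : U * Matrix.fromBlocks P 0 0 0 * U = Matrix.fromBlocks 0 0 0 Q := by
    simp only [U, fromBlocks_multiply, Matrix.sub_mul, Matrix.mul_sub, hP, hYP, Matrix.one_mul,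
      Matrix.mul_one, Matrix.mul_zero]
    simp [hYP, hYX']
  let e := Fintype.equivFin (ι ⊕ κ)
  have hV : reindex e e U * reindex e e U = 1 := by
    simp only [reindex_apply, submatrix_mul_equiv, hUU, submatrix_one_equiv]
  refine ⟨_, Function.Embedding.inl.trans e.toEmbedding, Function.Embedding.inr.trans e.toEmbedding,
    ⟨reindex e e U, reindex e e U, hV, hV⟩, ?_⟩
  rw [padMat_inl, padMat_inr, ← hconj]
  simp only [Units.inv_mk, reindex_apply, submatrix_mul_equiv]

theorem padMat_eq_mul {N : ℕ} (f : ι ↪ Fin N) (P : Matrix ι ι R) :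
    padMat f P = (1 : Matrix (Fin N) (Fin N) R).submatrix id f * P *
      (1 : Matrix (Fin N) (Fin N) R).submatrix f id := by
  ext i j
  simp only [padMat, Matrix.mul_apply, submatrix_apply, one_apply, id, ite_and, eq_comm (a := i),
    Finset.sum_mul]
  rw [Finset.sum_comm]
  refine Finset.sum_congr rfl fun a _ => Finset.sum_congr rfl fun b _ => ?_
  split_ifs <;> simp

theorem submatrix_one_mul_submatrix_one {α : Type*} [DecidableEq α] {N : ℕ} (f : α ↪ Fin N) :
    (1 : Matrix (Fin N) (Fin N) R).submatrix f id * (1 : Matrix (Fin N) (Fin N) R).submatrix id f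
      = 1 := by
  ext a b
  simp [Matrix.mul_apply, one_apply, f.injective.eq_iff]

theorem IdemEquiv.mvn {P : Matrix ι ι R} {Q : Matrix κ κ R} (hP : P * P = P) (hQ : Q * Q = Q)
    (h : IdemEquiv P Q) : MvN P Q := by
  classical
  obtain ⟨N, f, g, U, hU⟩ := h
  rw [padMat_eq_mul f, padMat_eq_mul g] at hU
  set J := (1 : Matrix (Fin N) (Fin N) R).submatrix id f
  set J' := (1 : Matrix (Fin N) (Fin N) R).submatrix f id
  set K := (1 : Matrix (Fin N) (Fin N) R).submatrix id g
  set K' := (1 : Matrix (Fin N) (Fin N) R).submatrix g id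
  have hJ : J' * J = 1 := submatrix_one_mul_submatrix_one f
  have hK : K' * K = 1 := submatrix_one_mul_submatrix_one g
  have hU' : (U⁻¹).val * (K * Q * K') * U.val = J * P * J' := by
    rw [← hU]
    simp [← Matrix.mul_assoc]
  refine ⟨J' * (U⁻¹).val * K * Q, K' * U.val * J * P, ?_, ?_⟩
  · calc J' * (U⁻¹).val * K * Q * (K' * U.val * J * P)
        = J' * ((U⁻¹).val * (K * Q * K') * U.val) * J * P := by simp only [Matrix.mul_assoc]
      _ = (J' * J) * P * (J' * J) * P := by rw [hU']; simp only [Matrix.mul_assoc]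
      _ = P := by simp [hJ, hP]
  · calc K' * U.val * J * P * (J' * (U⁻¹).val * K * Q)
        = K' * (U.val * (J * P * J') * (U⁻¹).val) * K * Q := by simp only [Matrix.mul_assoc]
      _ = (K' * K) * Q * (K' * K) * Q := by rw [hU]; simp only [Matrix.mul_assoc]
      _ = Q := by simp [hK, hQ]

end MvN

section ComplexIdempotent

open Matrix

/-- An idempotent complex matrix factors through its range. -/
theorem exists_factorization_of_idempotent {n : Type*} [Fintype n] {F : Matrix n n ℂ}
    (hF : F * F = F) :
    ∃ (l : ℕ) (A : Matrix (Fin l) n ℂ) (B : Matrix n (Fin l) ℂ), A * B = 1 ∧ B * A = F := by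
  classical
  let f : (n → ℂ) →ₗ[ℂ] (n → ℂ) := toLin' F
  have hf : ∀ v, f (f v) = f v := fun v => by simp [f, hF]
  let b := Module.finBasis ℂ (LinearMap.range f)
  let e := Pi.basisFun ℂ n
  refine ⟨_, LinearMap.toMatrix e b f.rangeRestrict,
    LinearMap.toMatrix b e (LinearMap.range f).subtype, ?_, ?_⟩
  · rw [← LinearMap.toMatrix_comp, ← LinearMap.toMatrix_id b]
    congr 1
    ext ⟨_, v, rfl⟩ : 2
    simp [hf]
  · rw [← LinearMap.toMatrix_comp]
    have : (LinearMap.range f).subtype ∘ₗ f.rangeRestrict = f := by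
      ext; simp
    rw [this]
    simp [e, f, LinearMap.toMatrix_eq_toMatrix']

theorem eq_zero_of_idempotent_of_trace_eq_zero {n : Type*} [Fintype n] {F : Matrix n n ℂ}
    (hF : F * F = F) (htr : F.trace = 0) : F = 0 := by
  obtain ⟨l, A, B, hAB, rfl⟩ := exists_factorization_of_idempotent hF
  rw [trace_mul_comm, hAB] at htr
  have hl : l = 0 := by simpa using htr
  subst hl
  ext i j
  simp [Matrix.mul_apply]

end ComplexIdempotent

section CircleIdempotent

open Matrix

attribute [local instance] Matrix.linftyOpNormedRing Matrix.linftyOpNormedAlgebra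

variable {n : Type*} [Fintype n] [DecidableEq n]

/-- The intertwiner of two idempotents `p` and `q`. -/
def intertwiner {A : Type*} [Ring A] (q p : A) : A := q * p + (1 - q) * (1 - p)

theorem intertwiner_mul {A : Type*} [Ring A] {q p : A} (hq : q * q = q) (hp : p * p = p) :
    intertwiner q p * p = q * intertwiner q p := by
  have h₁ : intertwiner q p * p = q * (p * p) + (1 - q) * (p - p * p) := by
    rw [intertwiner]; noncomm_ring
  have h₂ : q * intertwiner q p = (q * q) * p + (q - q * q) * (1 - p) := by
    rw [intertwiner]; noncomm_ring
  rw [h₁, h₂, hq, hp]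
  simp

theorem intertwiner_self {A : Type*} [Ring A] {p : A} (hp : p * p = p) : intertwiner p p = 1 := by
  have : intertwiner p p = p * p + (1 - p - p + p * p) := by rw [intertwiner]; noncomm_ring
  rw [this, hp]
  noncomm_ring

theorem isUnit_intertwiner {A : Type*} [NormedRing A] [CompleteSpace A] {q p : A}
    (hp : p * p = p) (h : ‖q - p‖ * ‖2 * p - 1‖ < 1) : IsUnit (intertwiner q p) := by
  have h₁ : intertwiner q p = 1 - (-((q - p) * (2 * p - 1))) := by
    have h₂ : 1 - (-((q - p) * (2 * p - 1)))
        = q * p + (1 - q) * (1 - p) - 2 * (p * p) + 2 * p := by noncomm_ring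
    rw [h₂, hp, intertwiner]
    noncomm_ring
  rw [h₁]
  exact (Units.oneSub _ (by rw [norm_neg]; exact (norm_mul_le _ _).trans_lt h)).isUnit

/-- Parallel transport along a path of idempotents. -/
theorem exists_transport {A : Type*} [NormedRing A] [CompleteSpace A] (p : ℝ → A)
    (hc : Continuous p) (hp : ∀ t, p t * p t = p t) :
    ∃ u : ℝ → A, Continuous u ∧ u 0 = 1 ∧
      ∀ t ∈ Set.Icc (0 : ℝ) 1, IsUnit (u t) ∧ u t * p 0 = p t * u t := by
  obtain ⟨C, hC⟩ := isCompact_Icc.exists_bound_of_continuousOn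
    (s := Set.Icc (0 : ℝ) 1) (f := fun t => 2 * p t - 1) (by fun_prop)
  have hC0 : 0 ≤ C := (norm_nonneg _).trans (hC 0 (by simp))
  have huc := isCompact_Icc.uniformContinuousOn_of_continuous
    (s := Set.Icc (0 : ℝ) 1) hc.continuousOn
  rw [Metric.uniformContinuousOn_iff] at huc
  obtain ⟨δ, hδ, huc⟩ := huc (1 / (C + 1)) (by positivity)
  obtain ⟨N, hN⟩ := exists_nat_one_div_lt hδ
  have step : ∀ j : ℕ, j ≤ N + 1 → ∃ u : ℝ → A, Continuous u ∧ u 0 = 1 ∧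
      ∀ t ∈ Set.Icc (0 : ℝ) 1, IsUnit (u t) ∧ u t * p 0 = p (min t (j / (N + 1))) * u t := by
    intro j
    induction j with
    | zero =>
      intro _
      exact ⟨fun _ => 1, continuous_const, rfl, fun t ht => by simp [min_eq_right ht.1]⟩
    | succ j ih =>
      intro hj
      obtain ⟨u, huc', hu0, hu⟩ := ih (by omega)
      refine ⟨fun t => intertwiner (p (min t ((j + 1 : ℕ) / (N + 1)))) (p (min t (j / (N + 1))))
        * u t, ?_, ?_, ?_⟩
      · unfold intertwiner
        fun_prop
      · have h₁ : min (0 : ℝ) ((j + 1 : ℕ) / (N + 1)) = 0 := min_eq_left (by positivity)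
        have h₂ : min (0 : ℝ) (j / (N + 1)) = 0 := min_eq_left (by positivity)
        simp only [h₁, h₂, hu0, intertwiner_self (hp 0), mul_one]
      · intro t ht
        obtain ⟨h₁, h₂⟩ := hu t ht
        refine ⟨IsUnit.mul (isUnit_intertwiner (hp _) ?_) h₁, ?_⟩
        · have hm : ∀ x : ℝ, 0 ≤ x → min t x ∈ Set.Icc (0 : ℝ) 1 := fun x hx =>
            ⟨le_min ht.1 hx, (min_le_left _ _).trans ht.2⟩
          have hd : dist (min t (((j + 1 : ℕ) : ℝ) / (N + 1))) (min t ((j : ℝ) / (N + 1))) < δ := by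
            rw [Real.dist_eq]
            refine lt_of_le_of_lt (abs_min_sub_min_le_max _ _ _ _) ?_
            have : ((j + 1 : ℕ) : ℝ) / (N + 1) - j / (N + 1) = 1 / (N + 1) := by
              push_cast; ring
            rw [this, sub_self, abs_zero, abs_of_pos (by positivity)]
            exact max_lt hδ hN
          have h₃ := huc _ (hm _ (by positivity)) _ (hm _ (by positivity)) hd
          rw [dist_eq_norm] at h₃
          calc _ ≤ (1 / (C + 1)) * C :=
                mul_le_mul h₃.le (hC _ (hm _ (by positivity))) (norm_nonneg _) (by positivity)
            _ < 1 := by rw [one_div_mul_eq_div, div_lt_one (by positivity)]; linarith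
        · rw [mul_assoc, h₂, ← mul_assoc, intertwiner_mul (hp _) (hp _), mul_assoc]
  obtain ⟨u, h₁, h₂, h₃⟩ := step (N + 1) le_rfl
  refine ⟨u, h₁, h₂, fun t ht => ?_⟩
  have h₄ : min t (((N + 1 : ℕ) : ℝ) / (N + 1)) = t := by
    rw [Nat.cast_add_one, div_self (by positivity)]
    exact min_eq_left ht.2
  simpa only [h₄] using h₃ t ht

/-- An invertible complex matrix can be joined to `1` by invertible elements of the algebra it
generates. -/
theorem exists_path_of_isUnit {g : Matrix n n ℂ} (hg : IsUnit g) :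
    ∃ γ : ℝ → ℂ, Continuous γ ∧ γ 0 = 0 ∧ γ 1 = 1 ∧ ∀ t, IsUnit (1 + γ t • (g - 1)) := by
  let d : Polynomial ℂ := (1 + (Polynomial.X : Polynomial ℂ) • (g - 1).map Polynomial.C).det
  have hd : ∀ z, d.eval z = (1 + z • (g - 1)).det := by
    intro z
    rw [← Polynomial.coe_evalRingHom, RingHom.map_det]
    congr 1
    ext i j
    by_cases hij : i = j
    · simp [hij]
    · simp [hij]
      exact mul_comm _ _
  have hd0 : d ≠ 0 := by
    intro h
    have := hd 0
    simp [h] at this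
  have hfin : {z | d.eval z = 0}.Finite := by
    refine (d.roots.toFinset.finite_toSet).subset fun z hz => ?_
    simpa [hd0] using hz
  have hpc := hfin.countable.isPathConnected_compl_of_one_lt_rank (E := ℂ)
    (by rw [Complex.rank_real_complex]; norm_num)
  have hj := hpc.joinedIn 0 (by simp [hd]) 1 (by
    simp only [Set.mem_compl_iff, Set.mem_ofPred_eq, hd, one_smul, add_sub_cancel]
    exact ((isUnit_iff_isUnit_det _).1 hg).ne_zero)
  obtain ⟨γ, hγ⟩ := hj
  refine ⟨γ.extend, γ.continuous_extend, by simp, by simp, fun t => ?_⟩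
  rw [isUnit_iff_isUnit_det, ← hd, isUnit_iff_ne_zero]
  have h := hγ (Set.projIcc 0 1 zero_le_one t)
  exact h

/-- Every loop of idempotent complex matrices is conjugate to a constant one. -/
theorem exists_conj_const (p : UnitAddCircle → Matrix n n ℂ) (hc : Continuous p)
    (hp : ∀ x, p x * p x = p x) :
    ∃ v : UnitAddCircle → Matrix n n ℂ, Continuous v ∧
      ∀ x, IsUnit (v x) ∧ v x * p 0 = p x * v x := by
  obtain ⟨u, huc, hu0, hu⟩ := exists_transport (fun t : ℝ => p (t : UnitAddCircle))
    (hc.comp (AddCircle.continuous_mk' 1)) (fun t => hp _)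
  obtain ⟨hg, hgp⟩ := hu 1 (by simp)
  have h1 : ((1 : ℝ) : UnitAddCircle) = 0 := AddCircle.coe_period 1
  simp only [h1, QuotientAddGroup.mk_zero] at hgp
  obtain ⟨g, hg'⟩ := hg
  have hcomm : g⁻¹.val * p 0 = p 0 * g⁻¹.val := by
    rw [Units.inv_mul_eq_iff_eq_mul, ← mul_assoc, hg', hgp, ← hg', mul_assoc, Units.mul_inv, mul_one]
  obtain ⟨γ, hγc, hγ0, hγ1, hγ⟩ := exists_path_of_isUnit (g := g⁻¹.val) (Units.isUnit _)
  let w : ℝ → Matrix n n ℂ := fun t => u t * (1 + γ t • (g⁻¹.val - 1))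
  have hw : ∀ t ∈ Set.Icc (0 : ℝ) 1, IsUnit (w t) ∧ w t * p 0 = p t * w t := by
    intro t ht
    obtain ⟨h₁, h₂⟩ := hu t ht
    refine ⟨h₁.mul (hγ t), ?_⟩
    have h₃ : (1 + γ t • (g⁻¹.val - 1)) * p 0 = p 0 * (1 + γ t • (g⁻¹.val - 1)) := by
      simp only [add_mul, mul_add, smul_mul_assoc, mul_smul_comm, sub_mul, mul_sub, hcomm, one_mul,
        mul_one]
    simp only [QuotientAddGroup.mk_zero] at h₂
    simp only [w]
    rw [mul_assoc, h₃, ← mul_assoc, h₂, mul_assoc]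
  refine ⟨AddCircle.liftIco 1 0 w, AddCircle.liftIco_zero_continuous ?_ ?_, fun x => ?_⟩
  · simp only [w, hu0, hγ0, hγ1, ← hg']
    simp
  · exact Continuous.continuousOn (by fun_prop)
  · obtain ⟨t, ht, rfl⟩ := (AddCircle.coe_image_Ico_eq (1 : ℝ) 0).symm ▸ Set.mem_univ x
    rw [AddCircle.liftIco_coe_apply ht]
    rw [zero_add] at ht
    exact hw t (Set.Ico_subset_Icc_self ht)

/-- Idempotent matrices of continuous functions on the circle come from trivial bundles. -/
theorem exists_factorization_circle (p : Matrix n n C(UnitAddCircle, ℂ)) (hp : p * p = p) :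
    ∃ (m : ℕ) (A : Matrix (Fin m) n C(UnitAddCircle, ℂ)) (B : Matrix n (Fin m) C(UnitAddCircle, ℂ)),
      A * B = 1 ∧ B * A = p := by
  let p' : UnitAddCircle → Matrix n n ℂ := fun x => p.map fun f => f x
  have hp' : ∀ x, p' x * p' x = p' x := by
    intro x
    ext i j
    have h := congrArg (fun f : C(UnitAddCircle, ℂ) => f x) (congrFun (congrFun hp i) j)
    simpa [p', Matrix.mul_apply] using h
  have hc : Continuous p' := continuous_matrix fun i j => (p i j).continuous
  obtain ⟨v, hvc, hv⟩ := exists_conj_const p' hc hp'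
  have hvi : Continuous fun x => (v x)⁻¹ := by
    rw [continuous_iff_continuousAt]
    intro x
    have hx := (hv x).1
    obtain ⟨w, hw⟩ := hx
    have h := NormedRing.inverse_continuousAt w
    rw [hw] at h
    have h' := ContinuousAt.comp (f := v) h hvc.continuousAt
    refine h'.congr (Filter.Eventually.of_forall fun y => ?_)
    simp [Matrix.nonsing_inv_eq_ringInverse]
  obtain ⟨m, A, B, hAB, hBA⟩ := exists_factorization_of_idempotent (hp' 0)
  refine ⟨m, Matrix.of fun i j => ⟨fun x => (A * (v x)⁻¹) i j, ?_⟩,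
    Matrix.of fun i j => ⟨fun x => (v x * B) i j, ?_⟩, ?_, ?_⟩
  · exact (continuous_const.matrix_mul hvi).matrix_elem i j
  · exact (hvc.matrix_mul continuous_const).matrix_elem i j
  · ext i j x
    have hx : A * (v x)⁻¹ * (v x * B) = 1 := by
      rw [Matrix.mul_assoc, ← Matrix.mul_assoc _ _ B,
        Matrix.nonsing_inv_mul _ ((isUnit_iff_isUnit_det _).1 (hv x).1), Matrix.one_mul, hAB]
    have h := congrFun (congrFun hx i) j
    rw [Matrix.mul_apply] at h ⊢
    by_cases hij : i = j <;> simpa [Matrix.one_apply, hij] using h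
  · ext i j x
    have hx : v x * B * (A * (v x)⁻¹) = p' x := by
      rw [Matrix.mul_assoc, ← Matrix.mul_assoc B, hBA, ← Matrix.mul_assoc, (hv x).2,
        Matrix.mul_assoc, Matrix.mul_nonsing_inv _ ((isUnit_iff_isUnit_det _).1 (hv x).1),
        Matrix.mul_one]
    have h := congrFun (congrFun hx i) j
    rw [Matrix.mul_apply] at h ⊢
    simpa [p'] using h

end CircleIdempotent

/-- A normed algebra with an isometry `s`, its adjoint `t`, the corner functional of `1 - s * t` and
a symbol map onto a dense subalgebra of the continuous functions on the circle, such that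
multiplying by high powers of `s` reduces the norm of an element to that of its symbol. -/
structure ToeplitzModel (R : Type*) [NormedRing R] [NormedAlgebra ℂ R] where
  s : R
  t : R
  t_mul_s : t * s = 1
  norm_t_pow_le : ∀ n : ℕ, ‖t ^ n‖ ≤ 1
  coeff : R →ₗ[ℂ] ℂ
  corner : ∀ a, (1 - s * t) * a * (1 - s * t) = coeff a • (1 - s * t)
  coeff_one_sub : coeff (1 - s * t) = 1
  symbol : R →ₐ[ℂ] C(UnitAddCircle, ℂ)
  denseRange_symbol : DenseRange symbol
  eventually_norm_lt : ∀ (a : R) (C : ℝ), ‖symbol a‖ < C → ∀ᶠ n : ℕ in Filter.atTop,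
    ‖a * s ^ n‖ < C

namespace ToeplitzModel

open Matrix Filter

attribute [local instance] Matrix.linftyOpNormedRing Matrix.linftyOpNormedAlgebra

variable {R : Type*} [NormedRing R] [NormedAlgebra ℂ R] (M : ToeplitzModel R)

/-- The rank-one projection of a Toeplitz model. -/
def q : R := 1 - M.s * M.t

theorem q_mul_s : M.q * M.s = 0 := by
  rw [q, sub_mul, one_mul, mul_assoc, M.t_mul_s, mul_one, sub_self]

theorem t_mul_q : M.t * M.q = 0 := by
  rw [q, mul_sub, mul_one, ← mul_assoc, M.t_mul_s, one_mul, sub_self]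

theorem q_mul_q : M.q * M.q = M.q := by
  conv_lhs => enter [2]; rw [q]
  rw [mul_sub, ← mul_assoc, q_mul_s, zero_mul, sub_zero, mul_one]

theorem t_pow_mul_s_pow (n : ℕ) : M.t ^ n * M.s ^ n = 1 := by
  induction n with
  | zero => simp
  | succ n ih =>
    rw [pow_succ, pow_succ' M.s, mul_assoc, ← mul_assoc M.t, M.t_mul_s, one_mul, ih]

theorem t_pow_mul_s_pow_of_le {a b : ℕ} (h : a ≤ b) : M.t ^ a * M.s ^ b = M.s ^ (b - a) := by
  obtain ⟨c, rfl⟩ := Nat.exists_eq_add_of_le h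
  rw [pow_add, ← mul_assoc, t_pow_mul_s_pow, one_mul, Nat.add_sub_cancel_left]

theorem t_pow_mul_s_pow_of_ge {a b : ℕ} (h : b ≤ a) : M.t ^ a * M.s ^ b = M.t ^ (a - b) := by
  obtain ⟨c, rfl⟩ := Nat.exists_eq_add_of_le h
  rw [add_comm, pow_add, mul_assoc, t_pow_mul_s_pow, mul_one, Nat.add_sub_cancel]

theorem q_mul_s_pow {n : ℕ} (hn : n ≠ 0) : M.q * M.s ^ n = 0 := by
  obtain ⟨n, rfl⟩ := Nat.exists_eq_succ_of_ne_zero hn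
  rw [pow_succ', ← mul_assoc, q_mul_s, zero_mul]

theorem t_pow_mul_q {n : ℕ} (hn : n ≠ 0) : M.t ^ n * M.q = 0 := by
  obtain ⟨n, rfl⟩ := Nat.exists_eq_succ_of_ne_zero hn
  rw [pow_succ, mul_assoc, t_mul_q, mul_zero]

theorem t_pow_mul_s_pow_mul_q {a b : ℕ} (h : b < a) : M.t ^ a * (M.s ^ b * M.q) = 0 := by
  rw [← mul_assoc, t_pow_mul_s_pow_of_ge _ h.le, t_pow_mul_q _ (by omega)]

theorem q_mul_t_pow_mul_s_pow {a b : ℕ} (h : a < b) : M.q * M.t ^ a * M.s ^ b = 0 := by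
  rw [mul_assoc, t_pow_mul_s_pow_of_le _ h.le, q_mul_s_pow _ (by omega)]

theorem matrix_unit_mul (a b : ℕ) :
    M.q * M.t ^ a * (M.s ^ b * M.q) = if a = b then M.q else 0 := by
  split_ifs with h
  · rw [h, mul_assoc, ← mul_assoc _ _ M.q, t_pow_mul_s_pow, one_mul, q_mul_q]
  · rcases lt_or_gt_of_ne h with h | h
    · rw [← mul_assoc, q_mul_t_pow_mul_s_pow _ h, zero_mul]
    · rw [mul_assoc, t_pow_mul_s_pow_mul_q _ h, mul_zero]

theorem sum_matrix_units (n : ℕ) :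
    ∑ a : Fin n, M.s ^ (a : ℕ) * M.q * (M.q * M.t ^ (a : ℕ)) = 1 - M.s ^ n * M.t ^ n := by
  rw [Fin.sum_univ_eq_sum_range fun a => M.s ^ a * M.q * (M.q * M.t ^ a)]
  induction n with
  | zero => simp
  | succ n ih =>
    rw [Finset.sum_range_succ, ih, mul_assoc, ← mul_assoc M.q, q_mul_q, q, pow_succ, pow_succ' M.t]
    noncomm_ring

theorem coeff_q : M.coeff M.q = 1 := M.coeff_one_sub

theorem q_mul_mul_q (a : R) : M.q * a * M.q = M.coeff a • M.q := M.corner a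

theorem symbol_q : M.symbol M.q = 0 := by
  have h := congrArg M.symbol M.t_mul_s
  rw [map_mul, map_one, mul_comm] at h
  rw [q, map_sub, map_one, map_mul, h, sub_self]

theorem coeff_mul_q_mul (a b : R) : M.coeff (a * M.q * b) = M.coeff a * M.coeff b := by
  have h : M.coeff (a * M.q * b) • M.q = (M.coeff a * M.coeff b) • M.q := by
    calc M.coeff (a * M.q * b) • M.q = (M.q * a * M.q) * (M.q * b * M.q) := by
          rw [← q_mul_mul_q]
          simp only [mul_assoc]
          rw [← mul_assoc M.q M.q, q_mul_q]
      _ = _ := by rw [q_mul_mul_q, q_mul_mul_q, smul_mul_smul_comm, q_mul_q]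
  simpa [coeff_q] using congrArg M.coeff h

theorem diagonal_q_mul_self {ι : Type*} [Fintype ι] [DecidableEq ι] :
    diagonal (fun _ : ι => M.q) * diagonal (fun _ => M.q) = diagonal fun _ => M.q := by
  simp [q_mul_q]

section Matrices

variable {ι : Type*} [Fintype ι] [DecidableEq ι]

theorem norm_le_of_entry_le {R : Type*} [NormedRing R] {X : Matrix ι ι R} {ε : ℝ}
    (hε : 0 ≤ ε) (h : ∀ i j, ‖X i j‖ ≤ ε) :
    ‖X‖ ≤ Fintype.card ι * ε := by
  lift ε to NNReal using hε
  rw [linfty_opNorm_def]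
  have : (Finset.univ.sup fun i : ι => ∑ j, ‖X i j‖₊) ≤ Fintype.card ι * ε :=
    Finset.sup_le fun i _ => (Finset.sum_le_card_nsmul _ _ ε (fun j _ => h i j)).trans (by simp)
  exact_mod_cast this

theorem eventually_norm_mul_lt (X : Matrix ι ι R) {δ : ℝ} (hδ : 0 < δ)
    (h : ∀ i j, ‖M.symbol (X i j)‖ < δ / (Fintype.card ι + 1)) :
    ∀ᶠ n : ℕ in atTop, ‖X * diagonal fun _ => M.s ^ n‖ < δ := by
  have h₁ : ∀ᶠ n : ℕ in atTop, ∀ i j, ‖X i j * M.s ^ n‖ < δ / (Fintype.card ι + 1) := by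
    simp only [eventually_all]
    exact fun i j => M.eventually_norm_lt _ _ (h i j)
  filter_upwards [h₁] with n hn
  calc _ ≤ Fintype.card ι * (δ / (Fintype.card ι + 1)) :=
        norm_le_of_entry_le (by positivity) fun i j => by
          rw [mul_diagonal]; exact (hn i j).le
    _ < δ := by
        rw [mul_div_assoc', div_lt_iff₀ (by positivity)]
        nlinarith

theorem norm_diagonal_t_pow_le (n : ℕ) : ‖diagonal fun _ : ι => M.t ^ n‖ ≤ 1 := by
  rw [linfty_opNorm_diagonal]
  exact (pi_norm_le_iff_of_nonneg zero_le_one).2 fun _ => M.norm_t_pow_le n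

/-- Idempotents with entries in the corner at `q` are equivalent to diagonal sums of `q`. -/
theorem exists_mvn_of_corner {F : Matrix ι ι R} (hF : F * F = F)
    (hq : diagonal (fun _ => M.q) * F * diagonal (fun _ => M.q) = F) :
    ∃ l : ℕ, MvN F (diagonal fun _ : Fin l => M.q) := by
  have hc : ∀ i j, F i j = M.coeff (F i j) • M.q := by
    intro i j
    conv_lhs => rw [← hq]
    rw [mul_diagonal, diagonal_mul, q_mul_mul_q]
  have hF₀ : F.map M.coeff * F.map M.coeff = F.map M.coeff := by
    ext i j
    conv_rhs => rw [← hF]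
    simp only [map_apply, Matrix.mul_apply, map_sum]
    refine Finset.sum_congr rfl fun a _ => ?_
    conv_rhs => rw [hc i a, hc a j, smul_mul_smul_comm, q_mul_q, map_smul, coeff_q, smul_eq_mul,
      mul_one]
  obtain ⟨l, A, B, hAB, hBA⟩ := exists_factorization_of_idempotent hF₀
  refine ⟨l, Matrix.of fun i j => B i j • M.q, Matrix.of fun i j => A i j • M.q, ?_, ?_⟩
  · ext i j
    rw [hc i j, ← map_apply (f := M.coeff), ← hBA]
    simp only [Matrix.mul_apply, of_apply, smul_mul_smul_comm, q_mul_q, Finset.sum_smul]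
  · ext i j
    have h : ((A * B) i j) • M.q = (1 : Matrix (Fin l) (Fin l) ℂ) i j • M.q := by rw [hAB]
    rw [Matrix.mul_apply, Finset.sum_smul] at h
    simp only [Matrix.mul_apply, of_apply, smul_mul_smul_comm, q_mul_q, h]
    by_cases hij : i = j <;> simp [one_apply, hij]

theorem hasSummableGeomSeries_matrix {R : Type*} [NormedRing R] [CompleteSpace R] :
    HasSummableGeomSeries (Matrix ι ι R) :=
  have : @CompleteSpace (Matrix ι ι R) PseudoMetricSpace.toUniformSpace :=
    inferInstanceAs (CompleteSpace (ι → ι → R))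
  inferInstance

variable [CompleteSpace R]

/-- Idempotents with vanishing symbol are equivalent to diagonal sums of `q`. -/
theorem exists_mvn_of_symbol_eq_zero {E : Matrix ι ι R} (hE : E * E = E)
    (h0 : ∀ i j, M.symbol (E i j) = 0) :
    ∃ l : ℕ, MvN E (diagonal fun _ : Fin l => M.q) := by
  have : HasSummableGeomSeries (Matrix ι ι R) := hasSummableGeomSeries_matrix
  obtain ⟨n, hn⟩ := (M.eventually_norm_mul_lt E (δ := 1 / (‖E‖ + 1)) (by positivity)
    (fun i j => by rw [h0, norm_zero]; positivity)).exists
  set D : Matrix ι ι R := diagonal fun _ => M.s ^ n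
  set D' : Matrix ι ι R := diagonal fun _ => M.t ^ n with hD'
  have hsmall : ‖E * D * (D' * E)‖ < 1 := by
    calc _ ≤ ‖E * D‖ * (‖D'‖ * ‖E‖) := (norm_mul_le _ _).trans (by gcongr; exact norm_mul_le _ _)
      _ ≤ 1 / (‖E‖ + 1) * (1 * ‖E‖) := by
        gcongr
        exact M.norm_diagonal_t_pow_le n
      _ < 1 := by rw [one_mul, one_div_mul_eq_div, div_lt_one (by positivity)]; linarith
  set x := E * D * (D' * E) with hx
  let u := Units.oneSub x hsmall
  have hu : u.val = 1 - x := rfl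
  have hEx : E * x = x := by simp only [hx, ← mul_assoc, hE]
  have hxE : x * E = x := by simp only [hx, mul_assoc, hE]
  have hcomm : E * u⁻¹.val = u⁻¹.val * E := by
    refine (Commute.units_inv_right (u := u) ?_).eq
    rw [Commute, SemiconjBy, hu, mul_sub, sub_mul, hEx, hxE, mul_one, one_mul]
  set y := u⁻¹.val * E with hy
  have hEy : E * y = y := by rw [hy, ← mul_assoc, hcomm, mul_assoc, hE]
  have hyE : y * E = y := by rw [hy, mul_assoc, hE]
  have hEQ : E * (1 - D * D') * y = E := by
    calc E * (1 - D * D') * y = E * (1 - D * D') * (E * y) := by rw [hEy]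
      _ = (E * E - x) * y := by rw [hx]; noncomm_ring
      _ = E * (1 - x) * y := by rw [mul_sub, mul_one, hE, hEx]
      _ = E := by rw [hy, ← hu, mul_assoc, Units.mul_inv_cancel_left, hE]
  let W : Matrix ι (ι × Fin n) R :=
    Matrix.of fun i a => if i = a.1 then M.s ^ (a.2 : ℕ) * M.q else 0
  let W' : Matrix (ι × Fin n) ι R :=
    Matrix.of fun a i => if i = a.1 then M.q * M.t ^ (a.2 : ℕ) else 0
  have hWW : W * W' = 1 - D * D' := by
    ext i j
    simp only [Matrix.mul_apply, W, W', of_apply, Fintype.sum_prod_type, ite_mul, zero_mul,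
      mul_ite, mul_zero, Matrix.sub_apply, D, D', diagonal_mul_diagonal]
    by_cases hij : i = j
    · subst hij
      simp [sum_matrix_units]
    · simp [hij]
  have hWq : W * diagonal (fun _ : ι × Fin n => M.q) = W := by
    ext i j
    simp [W, mul_assoc, q_mul_q]
  have hqW : diagonal (fun _ : ι × Fin n => M.q) * W' = W' := by
    ext i j
    simp [W', ← mul_assoc, q_mul_q]
  have hEF : MvN E (W' * y * W) := by
    refine ⟨E * W, W' * y, ?_, ?_⟩
    · rw [Matrix.mul_assoc, ← Matrix.mul_assoc W, hWW, ← Matrix.mul_assoc, hEQ]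
    · calc W' * y * (E * W) = W' * (y * E) * W := by simp only [Matrix.mul_assoc]
        _ = W' * y * W := by rw [hyE]
  have hF : (W' * y * W) * (W' * y * W) = W' * y * W := by
    calc (W' * y * W) * (W' * y * W) = W' * (y * E) * (W * W') * y * W := by
          rw [hyE]; simp only [Matrix.mul_assoc]
      _ = W' * (y * (E * (1 - D * D') * y)) * W := by rw [hWW]; simp only [Matrix.mul_assoc]
      _ = W' * y * W := by rw [hEQ, hyE]
  have hcorner : diagonal (fun _ : ι × Fin n => M.q) * (W' * y * W) *
      diagonal (fun _ : ι × Fin n => M.q) = W' * y * W := by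
    calc _ = (diagonal (fun _ : ι × Fin n => M.q) * W') * y *
          (W * diagonal (fun _ : ι × Fin n => M.q)) := by simp only [Matrix.mul_assoc]
      _ = W' * y * W := by rw [hWq, hqW]
  obtain ⟨l, hl⟩ := M.exists_mvn_of_corner hF hcorner
  exact ⟨l, hEF.trans hE M.diagonal_q_mul_self hl⟩

end Matrices

theorem mvn_one_fromBlocks (m l : ℕ) :
    MvN (fromBlocks (1 : Matrix (Fin (m + 1)) (Fin (m + 1)) R) 0 0 (diagonal fun _ : Fin l => M.q))
      (1 : Matrix (Fin (m + 1)) (Fin (m + 1)) R) := by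
  let D : Matrix (Fin (m + 1)) (Fin (m + 1)) R := diagonal fun i => if i = 0 then M.s ^ l else 1
  let D' : Matrix (Fin (m + 1)) (Fin (m + 1)) R := diagonal fun i => if i = 0 then M.t ^ l else 1
  let V : Matrix (Fin (m + 1)) (Fin l) R :=
    Matrix.of fun i j => if i = 0 then M.s ^ (j : ℕ) * M.q else 0
  let V' : Matrix (Fin l) (Fin (m + 1)) R :=
    Matrix.of fun j i => if i = 0 then M.q * M.t ^ (j : ℕ) else 0
  refine ⟨fromRows D' V', fromCols D V, ?_, ?_⟩
  · rw [fromRows_mul_fromCols]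
    congr 1
    · rw [diagonal_mul_diagonal, ← diagonal_one]
      congr 1
      ext i
      by_cases hi : i = 0 <;> simp [hi, t_pow_mul_s_pow]
    · ext i j
      by_cases hi : i = 0 <;> simp [D', V, hi, t_pow_mul_s_pow_mul_q]
    · ext i j
      by_cases hj : j = 0 <;> simp [D, V', hj, q_mul_t_pow_mul_s_pow]
    · ext i j
      simp only [V, V', Matrix.mul_apply, of_apply, mul_ite, ite_mul, zero_mul, mul_zero,
        matrix_unit_mul, diagonal_apply, Fin.ext_iff, Fin.val_zero]
      simp
  · rw [fromCols_mul_fromRows]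
    have h : V * V' = diagonal fun i => if i = 0 then 1 - M.s ^ l * M.t ^ l else 0 := by
      ext i j
      rcases eq_or_ne i 0 with rfl | hi
      · rcases eq_or_ne j 0 with rfl | hj
        · simp [V, V', Matrix.mul_apply, sum_matrix_units]
        · simp [V, V', Matrix.mul_apply, hj, hj.symm]
      · simp [V, V', Matrix.mul_apply, hi, diagonal_apply]
    rw [h, diagonal_mul_diagonal, diagonal_add, ← diagonal_one]
    congr 1
    ext i
    by_cases hi : i = 0 <;> simp [hi]

section Compress

theorem denseRange_map_symbol {ι κ : Type*} :
    DenseRange fun X : Matrix ι κ R => X.map M.symbol :=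
  DenseRange.piMap fun _ : ι => DenseRange.piMap fun _ : κ => M.denseRange_symbol

variable {ι κ : Type*} [Fintype ι] [Fintype κ] [DecidableEq κ]

/-- A factorization of the symbol of `P` lifts approximately to `R`. -/
theorem exists_approx_factorization {P : Matrix ι ι R}
    {A : Matrix κ ι C(UnitAddCircle, ℂ)} {B : Matrix ι κ C(UnitAddCircle, ℂ)}
    (h : A * P.map M.symbol * B = 1) {ε : ℝ} (hε : 0 < ε) :
    ∃ (a : Matrix κ ι R) (b : Matrix ι κ R), ∀ i j,
      ‖M.symbol ((a * P * b - 1 : Matrix κ κ R) i j)‖ < ε := by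
  have hd := (M.denseRange_map_symbol (ι := κ) (κ := ι)).prodMap
    (M.denseRange_map_symbol (ι := ι) (κ := κ))
  have hopen : IsOpen {x : Matrix κ ι C(UnitAddCircle, ℂ) × Matrix ι κ C(UnitAddCircle, ℂ) |
      ∀ i j, ‖(x.1 * P.map M.symbol * x.2 - 1 : Matrix κ κ C(UnitAddCircle, ℂ)) i j‖ < ε} := by
    simp only [Set.ofPred_forall]
    refine isOpen_iInter_of_finite fun i => isOpen_iInter_of_finite fun j => ?_
    refine isOpen_lt ?_ continuous_const
    refine (Continuous.matrix_elem ?_ i j).norm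
    exact (((continuous_fst.matrix_mul continuous_const).matrix_mul continuous_snd).sub
      continuous_const)
  obtain ⟨⟨a, b⟩, hab⟩ := hd.exists_mem_open hopen ⟨(A, B), by simp [h, hε]⟩
  refine ⟨a, b, fun i j => ?_⟩
  have hm : ((a * P * b - 1).map M.symbol) =
      a.map M.symbol * P.map M.symbol * b.map M.symbol - 1 := by
    rw [Matrix.map_sub _ (map_sub M.symbol), Matrix.map_mul, Matrix.map_mul,
      Matrix.map_one _ (map_zero _) (map_one _)]
  have h₁ : ‖((a * P * b - 1).map M.symbol) i j‖ < ε := by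
    rw [hm]
    exact hab i j
  exact h₁

variable [CompleteSpace R]

/-- An idempotent whose symbol factors through a free module of rank `m` splits off a free summand
of rank `m`, with a complement of vanishing symbol. -/
theorem exists_splitting {P : Matrix ι ι R} (hP : P * P = P)
    {A : Matrix κ ι C(UnitAddCircle, ℂ)} {B : Matrix ι κ C(UnitAddCircle, ℂ)}
    (hAB : A * B = 1) (hBA : B * A = P.map M.symbol) :
    ∃ e : Matrix ι ι R, e * e = e ∧ e * P = e ∧ P * e = e ∧ MvN e (1 : Matrix κ κ R) ∧
      ∀ i j, M.symbol ((P - e) i j) = 0 := by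
  have : HasSummableGeomSeries (Matrix κ κ R) := hasSummableGeomSeries_matrix
  obtain ⟨a, b, hab⟩ := M.exists_approx_factorization (P := P) (A := A) (B := B)
    (by rw [← hBA, ← Matrix.mul_assoc, hAB, Matrix.one_mul, hAB])
    (ε := 1 / (Fintype.card κ + 1)) (by positivity)
  obtain ⟨n, hn⟩ := (M.eventually_norm_mul_lt (a * P * b - 1) one_pos hab).exists
  set D : Matrix κ κ R := diagonal fun _ => M.s ^ n with hD
  set D' : Matrix κ κ R := diagonal fun _ => M.t ^ n with hD'
  have hDD : D' * D = 1 := by simp [hD, hD', t_pow_mul_s_pow]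
  have hsmall : ‖-(D' * ((a * P * b - 1) * D))‖ < 1 := by
    rw [norm_neg]
    calc _ ≤ ‖D'‖ * ‖(a * P * b - 1) * D‖ := norm_mul_le _ _
      _ ≤ 1 * ‖(a * P * b - 1) * D‖ := by
        gcongr
        exact M.norm_diagonal_t_pow_le n
      _ < 1 := by rwa [one_mul]
  let u := Units.oneSub _ hsmall
  have hu : u.val = D' * a * P * (P * b * D) := by
    calc u.val = 1 + D' * ((a * P * b - 1) * D) := by simp [u]
      _ = 1 + D' * (a * P * b) * D - D' * D := by
        rw [sub_mul, mul_sub, one_mul, mul_assoc, add_sub_assoc]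
      _ = D' * (a * (P * P) * b) * D := by rw [hDD, hP]; abel
      _ = _ := by simp only [Matrix.mul_assoc]
  set X := P * b * D * u⁻¹.val with hX
  set Y := D' * a * P with hY
  have hPX : P * X = X := by simp only [hX, ← Matrix.mul_assoc, hP]
  have hYP : Y * P = Y := by rw [hY, Matrix.mul_assoc, hP]
  have hYX : Y * X = 1 := by
    rw [hX, ← Matrix.mul_assoc, ← hu, Units.mul_inv]
  clear_value X Y
  have hee : X * Y * (X * Y) = X * Y := by
    rw [Matrix.mul_assoc, ← Matrix.mul_assoc Y, hYX, Matrix.one_mul]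
  have heP : X * Y * P = X * Y := by rw [Matrix.mul_assoc, hYP]
  have hPe : P * (X * Y) = X * Y := by rw [← Matrix.mul_assoc, hPX]
  refine ⟨X * Y, hee, heP, hPe, ⟨X, Y, rfl, hYX⟩, ?_⟩
  have hE : (P - X * Y) * (P - X * Y) = P - X * Y := by
    rw [sub_mul, mul_sub, mul_sub, hP, heP, hPe, hee]; abel
  have htr : trace ((P - X * Y).map M.symbol) = 0 := by
    rw [Matrix.map_sub _ (map_sub M.symbol), trace_sub, Matrix.map_mul, trace_mul_comm,
      ← Matrix.map_mul, hYX, ← hBA, trace_mul_comm, hAB, Matrix.map_one _ (map_zero _) (map_one _),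
      sub_self]
  intro i j
  ext z
  let ev : C(UnitAddCircle, ℂ) →+* ℂ := (ContinuousMap.evalAlgHom ℂ ℂ z).toRingHom
  have h0 := eq_zero_of_idempotent_of_trace_eq_zero
    (F := (((P - X * Y).map M.symbol).map ev)) (by
      rw [← Matrix.map_mul, ← Matrix.map_mul, hE]) (by
      rw [← AddMonoidHom.map_trace ev, htr, map_zero])
  exact congrFun (congrFun h0 i) j

end Compress

theorem canonMat_mul_self (c : ℕ ⊕ ℕ) : canonMat M.q c * canonMat M.q c = canonMat M.q c := by
  cases c with
  | inl l => exact M.diagonal_q_mul_self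
  | inr m =>
    have h : diagonal (fun _ : Fin (m + 1) => (1 : R)) * diagonal (fun _ : Fin (m + 1) => (1 : R)) =
        diagonal fun _ => 1 := by rw [diagonal_one, mul_one]
    exact h

/-- Every idempotent matrix is equivalent to a matrix in the canonical list. -/
theorem exists_mvn_canonMat [CompleteSpace R] {ι : Type*} [Fintype ι] [DecidableEq ι]
    {P : Matrix ι ι R} (hP : P * P = P) : ∃ c, MvN P (canonMat M.q c) := by
  obtain ⟨m, A, B, hAB, hBA⟩ := exists_factorization_circle (P.map M.symbol)
    (by rw [← Matrix.map_mul, hP])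
  obtain ⟨e, hee, heP, hPe, he, h0⟩ := M.exists_splitting hP hAB hBA
  have hE : (P - e) * (P - e) = P - e := by
    rw [sub_mul, mul_sub, mul_sub, hP, heP, hPe, hee]; abel
  obtain ⟨l, hl⟩ := M.exists_mvn_of_symbol_eq_zero hE h0
  cases m with
  | zero =>
    obtain ⟨X, Y, rfl, -⟩ := he
    have hXY : X * Y = 0 := by ext; simp [Matrix.mul_apply]
    rw [hXY, sub_zero] at hl
    exact ⟨Sum.inl l, hl⟩
  | succ m =>
    refine ⟨Sum.inr m, ?_⟩
    have h₁ : MvN P (fromBlocks e 0 0 (P - e)) := by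
      have := mvn_add_fromBlocks hee hE (by rw [mul_sub, heP, hee, sub_self])
        (by rw [sub_mul, hPe, hee, sub_self])
      rwa [add_sub_cancel] at this
    have h₂ := h₁.trans hP (by simp [fromBlocks_multiply, q_mul_q]) (he.fromBlocks hl)
    have h₃ := h₂.trans hP (by simp) (M.mvn_one_fromBlocks m l)
    rwa [← diagonal_one] at h₃

/-- The value of the symbol at the base point of the circle. -/
def symbolAt : R →+* ℂ := ((ContinuousMap.evalAlgHom ℂ ℂ 0).comp M.symbol).toRingHom

theorem symbolAt_q : M.symbolAt M.q = 0 := by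
  change M.symbol M.q 0 = 0
  rw [symbol_q, ContinuousMap.zero_apply]

theorem trace_symbolAt_eq {ι κ : Type*} [Fintype ι] [Fintype κ] {P : Matrix ι ι R}
    {Q : Matrix κ κ R} (h : MvN P Q) :
    trace (P.map M.symbolAt) = trace (Q.map M.symbolAt) := by
  obtain ⟨X, Y, rfl, rfl⟩ := h
  rw [Matrix.map_mul, Matrix.map_mul, trace_mul_comm]

theorem trace_symbolAt_canonMat (c : ℕ ⊕ ℕ) :
    trace ((canonMat M.q c).map M.symbolAt) =
      ((Sum.elim (fun _ => 0) (fun m => m + 1) c : ℕ) : ℂ) := by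
  cases c with
  | inl l =>
    change trace ((diagonal fun _ : Fin l => M.q).map M.symbolAt) = _
    simp [diagonal_map, symbolAt_q]
  | inr m =>
    change trace ((diagonal fun _ : Fin (m + 1) => (1 : R)).map M.symbolAt) = _
    simp

theorem eq_of_mvn_diagonal_q {l l' : ℕ}
    (h : MvN (diagonal fun _ : Fin l => M.q) (diagonal fun _ : Fin l' => M.q)) : l = l' := by
  have key : ∀ {k k' : ℕ} {X : Matrix (Fin k) (Fin k') R} {Y : Matrix (Fin k') (Fin k) R},
      X * Y = diagonal (fun _ : Fin k => M.q) → Y * X = diagonal (fun _ : Fin k' => M.q) →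
      X.map M.coeff * Y.map M.coeff = 1 := by
    intro k k' X Y hXY hYX
    have h : X * diagonal (fun _ : Fin k' => M.q) * Y = diagonal (fun _ : Fin k => M.q) := by
      rw [← hYX, ← Matrix.mul_assoc, Matrix.mul_assoc _ X Y, hXY, diagonal_q_mul_self]
    have hc := congrArg (fun Z => Z.map M.coeff) h
    rw [diagonal_map (map_zero _)] at hc
    simp only [coeff_q, diagonal_one] at hc
    rw [← hc]
    ext i j
    simp only [map_apply, Matrix.mul_apply (N := Y), Matrix.mul_apply (N := Y.map M.coeff),
      mul_diagonal, map_sum, coeff_mul_q_mul]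
  obtain ⟨X, Y, hXY, hYX⟩ := h
  simpa using square_of_invertible _ _ (key hXY hYX) (key hYX hXY)

theorem eq_of_mvn_canonMat {c c' : ℕ ⊕ ℕ} (h : MvN (canonMat M.q c) (canonMat M.q c')) :
    c = c' := by
  have ht := M.trace_symbolAt_eq h
  rw [trace_symbolAt_canonMat, trace_symbolAt_canonMat, Nat.cast_inj] at ht
  rcases c with l | m <;> rcases c' with l' | m'
  · exact congrArg Sum.inl (M.eq_of_mvn_diagonal_q h)
  · simp at ht
  · simp at ht
  · simpa using ht

/-- The classification of idempotent matrices over a Toeplitz model. -/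
theorem existsUnique_idemEquiv_canonMat [CompleteSpace R] {ι : Type*} [Fintype ι] [DecidableEq ι]
    {P : Matrix ι ι R} (hP : P * P = P) : ∃! c, IdemEquiv P (canonMat M.q c) := by
  obtain ⟨c, hc⟩ := M.exists_mvn_canonMat hP
  refine ⟨c, hc.idemEquiv hP (M.canonMat_mul_self c), fun c' hc' => ?_⟩
  exact M.eq_of_mvn_canonMat ((hc'.mvn hP (M.canonMat_mul_self c')).symm.trans
    (M.canonMat_mul_self c') (M.canonMat_mul_self c) hc)

theorem not_idemEquiv_canonMat {c c' : ℕ ⊕ ℕ} (h : c ≠ c') :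
    ¬ IdemEquiv (canonMat M.q c) (canonMat M.q c') := fun he =>
  h (M.eq_of_mvn_canonMat (he.mvn (M.canonMat_mul_self c) (M.canonMat_mul_self c')))

end ToeplitzModel

section Dilation

open Polynomial

variable {A : Type*} [CStarAlgebra A]

/-- The unitary dilation of an isometry. -/
def isometryDilation (s : A) : CStarMatrix (Fin 2) (Fin 2) A :=
  CStarMatrix.ofMatrix !![s, 1 - s * star s; 0, star s]

theorem isometryDilation_mem_unitary {s : A} (hs : star s * s = 1) :
    isometryDilation s ∈ unitary (CStarMatrix (Fin 2) (Fin 2) A) := by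
  have h₁ : star s * (s * star s) = star s := by rw [← mul_assoc, hs, one_mul]
  have h₂ : s * star s * s = s := by rw [mul_assoc, hs, mul_one]
  have h₃ : s * star s * (s * star s) = s * star s := by rw [← mul_assoc, h₂]
  rw [Unitary.mem_iff]
  constructor <;>
  · ext i j
    rw [CStarMatrix.mul_apply]
    fin_cases i <;> fin_cases j <;>
      simp [isometryDilation, CStarMatrix.star_apply, Fin.sum_univ_two, hs, mul_sub,
         sub_mul, h₁, h₂, h₃]

theorem aeval_isometryDilation (s : A) (p : ℂ[X]) :
    aeval (isometryDilation s) p 0 0 = aeval s p ∧ aeval (isometryDilation s) p 1 0 = 0 := by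
  induction p using Polynomial.induction_on with
  | C a => simp [CStarMatrix.algebraMap_apply]
  | add p q hp hq =>
    rw [map_add, map_add, CStarMatrix.add_apply, CStarMatrix.add_apply, hp.1, hp.2, hq.1, hq.2]
    simp
  | monomial n a h =>
    have hX : C a * X ^ (n + 1) = X * (C a * X ^ n) := by ring
    rw [hX, map_mul _ X, map_mul _ X, aeval_X, aeval_X, CStarMatrix.mul_apply, CStarMatrix.mul_apply,
      Fin.sum_univ_two, Fin.sum_univ_two, h.1, h.2]
    simp [isometryDilation]

/-- Von Neumann's inequality for isometries. -/
theorem norm_aeval_le_of_isometry [PartialOrder A] [StarOrderedRing A] {s : A}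
    (hs : star s * s = 1) (p : ℂ[X]) {C : ℝ} (hC : 0 ≤ C) (h : ∀ z : ℂ, ‖z‖ = 1 → ‖p.eval z‖ ≤ C) :
    ‖aeval s p‖ ≤ C := by
  have hU := isometryDilation_mem_unitary hs
  rw [← (aeval_isometryDilation s p).1]
  refine CStarMatrix.norm_entry_le_norm.trans ?_
  have : IsStarNormal (isometryDilation s) := isStarNormal_of_mem_unitary hU
  rw [← cfc_polynomial p (isometryDilation s)]
  refine norm_cfc_le hC fun z hz => h z ?_
  simpa using spectrum.subset_circle_of_unitary hU hz

end Dilation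

section Shift

open Filter Topology Polynomial
open scoped InnerProductSpace

theorem clm_ext_delta1 {F : Type*} [NormedAddCommGroup F] [NormedSpace ℂ F] {f g : H1 →L[ℂ] F}
    (h : ∀ j, f (delta1 j) = g (delta1 j)) : f = g := by
  refine lp.ext_continuousLinearMap (by simp) fun i => ?_
  ext
  simpa [delta1] using h i

theorem inner_delta1_left (i : ℕ) (f : H1) : ⟪delta1 i, f⟫_ℂ = f i := by
  simp [delta1, lp.inner_single_left]

theorem delta1_apply (i j : ℕ) : delta1 i j = if i = j then 1 else 0 := by
  simp [delta1, lp.single_apply, Pi.single_apply, eq_comm]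

theorem orthonormal_delta1 : Orthonormal ℂ delta1 := by
  rw [orthonormal_iff_ite]
  intro i j
  rw [inner_delta1_left, delta1_apply]
  simp [eq_comm]

variable {S : H1 →L[ℂ] H1}

theorem IsShift1.ext {T : H1 →L[ℂ] H1} (hS : IsShift1 S) (hT : IsShift1 T) : T = S :=
  clm_ext_delta1 fun j => by rw [hS, hT]

theorem IsShift1.star_delta1_succ (hS : IsShift1 S) (j : ℕ) :
    star S (delta1 (j + 1)) = delta1 j := by
  ext i
  rw [← inner_delta1_left, ContinuousLinearMap.star_eq_adjoint,
    ContinuousLinearMap.adjoint_inner_right, hS, inner_delta1_left, delta1_apply, delta1_apply]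
  simp

theorem IsShift1.star_delta1_zero (hS : IsShift1 S) : star S (delta1 0) = 0 := by
  ext i
  rw [← inner_delta1_left, ContinuousLinearMap.star_eq_adjoint,
    ContinuousLinearMap.adjoint_inner_right, hS, inner_delta1_left, delta1_apply]
  simp

theorem IsShift1.star_mul_self (hS : IsShift1 S) : star S * S = 1 :=
  clm_ext_delta1 fun j => by
    rw [mul_apply_eq_comp, hS, hS.star_delta1_succ, one_apply_eq_self]

theorem IsShift1.one_sub_apply (hS : IsShift1 S) (f : H1) :
    (1 - S * star S) f = f 0 • delta1 0 := by
  have h : 1 - S * star S = (innerSL ℂ (delta1 0)).smulRight (delta1 0) := by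
    refine clm_ext_delta1 fun j => ?_
    cases j with
    | zero =>
      simp [hS.star_delta1_zero, orthonormal_delta1.norm_eq_one]
    | succ j =>
      simp [hS.star_delta1_succ, hS j, inner_delta1_left, delta1_apply]
  rw [h]
  simp [inner_delta1_left]

theorem IsShift1.corner (hS : IsShift1 S) (a : H1 →L[ℂ] H1) :
    (1 - S * star S) * a * (1 - S * star S) = (a (delta1 0) 0) • (1 - S * star S) := by
  ext1 f
  simp only [mul_apply_eq_comp, _root_.smul_apply, hS.one_sub_apply,
    map_smul, smul_smul]
  congr 1
  exact mul_comm _ _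

theorem IsShift1.norm_pow_le (hS : IsShift1 S) (n : ℕ) : ‖S ^ n‖ ≤ 1 := by
  have h : ‖S ^ n‖ * ‖S ^ n‖ ≤ 1 := by
    rw [← CStarRing.norm_star_mul_self, star_pow, pow_mul_pow_eq_one n hS.star_mul_self]
    exact ContinuousLinearMap.norm_id_le
  nlinarith [norm_nonneg (S ^ n)]

theorem IsShift1.norm_star_pow_le (hS : IsShift1 S) (n : ℕ) : ‖star S ^ n‖ ≤ 1 := by
  rw [← star_pow]
  exact (norm_star (S ^ n)).trans_le (hS.norm_pow_le n)

theorem mem_toeplitz1_iff {a : H1 →L[ℂ] H1} : a ∈ Toeplitz1 ↔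
    a ∈ closure (StarAlgebra.adjoin ℂ {T : H1 →L[ℂ] H1 | IsShift1 T} : Set (H1 →L[ℂ] H1)) := by
  rw [Toeplitz1, ← SetLike.mem_coe, StarSubalgebra.topologicalClosure_coe]

/-- Induction for the polynomial algebra generated by the shift and its adjoint. -/
theorem IsShift1.adjoin_induction (hS : IsShift1 S) {p : (H1 →L[ℂ] H1) → Prop} (shift : p S)
    (star_shift : p (star S)) (scalar : ∀ c : ℂ, p (algebraMap ℂ _ c))
    (hadd : ∀ a b, p a → p b → p (a + b)) (hmul : ∀ a b, p a → p b → p (a * b))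
    {a : H1 →L[ℂ] H1} (ha : a ∈ StarAlgebra.adjoin ℂ {T : H1 →L[ℂ] H1 | IsShift1 T}) : p a := by
  rw [← StarSubalgebra.mem_toSubalgebra, StarAlgebra.adjoin_toSubalgebra] at ha
  induction ha using Algebra.adjoin_induction with
  | mem x hx =>
    rcases hx with hx | hx
    · rwa [hS.ext hx]
    · rwa [← star_star x, hS.ext hx]
  | algebraMap c => exact scalar c
  | add a b _ _ ha hb => exact hadd a b ha hb
  | mul a b _ _ ha hb => exact hmul a b ha hb

theorem IsShift1.exists_mul_pow_eq_aeval (hS : IsShift1 S) {a : H1 →L[ℂ] H1}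
    (ha : a ∈ StarAlgebra.adjoin ℂ {T : H1 →L[ℂ] H1 | IsShift1 T}) :
    ∃ (n : ℕ) (p : ℂ[X]), a * S ^ n = aeval S p := by
  refine hS.adjoin_induction (p := fun a => ∃ (n : ℕ) (p : ℂ[X]), a * S ^ n = aeval S p)
    ⟨0, X, by simp⟩ ⟨1, 1, by simp [hS.star_mul_self]⟩ (fun c => ⟨0, C c, by simp⟩) ?_ ?_ ha
  · rintro a b ⟨n, p, hp⟩ ⟨m, r, hr⟩
    refine ⟨n + m, p * X ^ m + r * X ^ n, ?_⟩
    simp only [map_add, map_mul, ← hp, ← hr, map_pow, aeval_X, add_mul]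
    rw [mul_assoc, mul_assoc, ← pow_add, ← pow_add, add_comm m n]
  · rintro a b ⟨n, p, hp⟩ ⟨m, r, hr⟩
    refine ⟨m + n, p * r, ?_⟩
    have hcomm : aeval S r * S ^ n = S ^ n * aeval S r := by
      simpa using congrArg (aeval S) (mul_comm r (X ^ n))
    rw [pow_add, ← mul_assoc, mul_assoc a, hr, mul_assoc, hcomm, ← mul_assoc, hp, map_mul]

end Shift

section Symbol

open Filter Topology
open scoped InnerProductSpace

/-- Unit vectors that are asymptotically eigenvectors of the shift at `z`, for `‖z‖ = 1`. -/
def approxEigenvector (z : ℂ) (n : ℕ) : H1 :=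
  ((√(n + 1 : ℝ))⁻¹ : ℝ) • ∑ j ∈ Finset.range (n + 1), (starRingEnd ℂ z) ^ j • delta1 j

theorem norm_approxEigenvector {z : ℂ} (hz : ‖z‖ = 1) (n : ℕ) : ‖approxEigenvector z n‖ = 1 := by
  have h : ‖∑ j ∈ Finset.range (n + 1), (starRingEnd ℂ z) ^ j • delta1 j‖ = √(n + 1 : ℝ) := by
    rw [norm_eq_sqrt_re_inner (𝕜 := ℂ), orthonormal_delta1.inner_sum]
    simp only [RCLike.conj_mul, norm_pow, RCLike.norm_conj, hz]
    simp
  rw [approxEigenvector, norm_smul, h, norm_inv, Real.norm_of_nonneg (Real.sqrt_nonneg _)]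
  exact inv_mul_cancel₀ (by positivity)

variable {S : H1 →L[ℂ] H1}

theorem IsShift1.apply_sum_sub (hS : IsShift1 S) {z : ℂ} (hz : ‖z‖ = 1) (n : ℕ) :
    S (∑ j ∈ Finset.range (n + 1), (starRingEnd ℂ z) ^ j • delta1 j) -
      z • ∑ j ∈ Finset.range (n + 1), (starRingEnd ℂ z) ^ j • delta1 j =
      (starRingEnd ℂ z) ^ n • delta1 (n + 1) - z • delta1 0 := by
  have hzz : z * starRingEnd ℂ z = 1 := by rw [RCLike.mul_conj, hz]; simp
  induction n with
  | zero => simp [hS 0]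
  | succ n ih =>
    rw [Finset.sum_range_succ, map_add, smul_add, map_smul, hS, add_sub_add_comm, ih, smul_smul,
      pow_succ', ← mul_assoc, hzz, one_mul]
    abel

theorem IsShift1.norm_apply_approxEigenvector_sub_le (hS : IsShift1 S) {z : ℂ} (hz : ‖z‖ = 1)
    (n : ℕ) :
    ‖S (approxEigenvector z n) - z • approxEigenvector z n‖ ≤ (√(n + 1 : ℝ))⁻¹ * 2 := by
  rw [approxEigenvector, ContinuousLinearMap.map_smul_of_tower, smul_comm z, ← smul_sub,
    hS.apply_sum_sub hz, norm_smul, norm_inv, Real.norm_of_nonneg (Real.sqrt_nonneg _)]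
  gcongr
  refine (norm_sub_le _ _).trans ?_
  simp only [norm_smul, norm_pow, RCLike.norm_conj, hz, orthonormal_delta1.norm_eq_one]
  norm_num

theorem IsShift1.tendsto_apply_approxEigenvector_sub (hS : IsShift1 S) {z : ℂ} (hz : ‖z‖ = 1) :
    Tendsto (fun n => S (approxEigenvector z n) - z • approxEigenvector z n) atTop (𝓝 0) := by
  refine squeeze_zero_norm (hS.norm_apply_approxEigenvector_sub_le hz) ?_
  have h : Tendsto (fun n : ℕ => √(n + 1 : ℝ)) atTop atTop :=
    Real.tendsto_sqrt_atTop.comp (tendsto_atTop_add_const_right _ _ tendsto_natCast_atTop_atTop)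
  simpa using h.inv_tendsto_atTop.mul_const 2

theorem norm_fourier_one_apply (x : UnitAddCircle) : ‖fourier 1 x‖ = 1 := by
  rw [fourier_one, Circle.norm_coe]

/-- `a` acts asymptotically as multiplication by `f x` on the approximate eigenvectors at `x`. -/
def HasSymbol (a : H1 →L[ℂ] H1) (f : C(UnitAddCircle, ℂ)) : Prop :=
  ∀ x, Tendsto (fun n => a (approxEigenvector (fourier 1 x) n) -
    f x • approxEigenvector (fourier 1 x) n) atTop (𝓝 0)

namespace HasSymbol

variable {a b : H1 →L[ℂ] H1} {f g : C(UnitAddCircle, ℂ)}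

theorem shift (hS : IsShift1 S) : HasSymbol S (fourier 1) := fun x =>
  hS.tendsto_apply_approxEigenvector_sub (norm_fourier_one_apply x)

theorem star_shift (hS : IsShift1 S) : HasSymbol (star S) (fourier (-1)) := by
  intro x
  set z := fourier 1 x with hz
  have hzz : starRingEnd ℂ z * z = 1 := by
    rw [RCLike.conj_mul, norm_fourier_one_apply]; simp
  have h := (((star S).continuous.tendsto 0).comp (shift hS x)).const_smul (-starRingEnd ℂ z)
  rw [map_zero, smul_zero] at h
  refine h.congr fun n => ?_
  have hSS (v : H1) : star S (S v) = v := DFunLike.congr_fun hS.star_mul_self v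
  simp only [Function.comp_apply, map_sub, map_smul, hSS, fourier_neg, ← hz, smul_sub, smul_smul,
    neg_mul, hzz, neg_smul, one_smul]
  abel

theorem algebraMap (c : ℂ) : HasSymbol (algebraMap ℂ _ c) (algebraMap ℂ _ c) := by
  intro x
  simp [Algebra.algebraMap_eq_smul_one]

theorem add (ha : HasSymbol a f) (hb : HasSymbol b g) : HasSymbol (a + b) (f + g) := by
  intro x
  have h := (ha x).add (hb x)
  rw [add_zero] at h
  refine h.congr fun n => ?_
  simp only [ContinuousMap.add_apply, _root_.add_apply, add_smul]
  abel

theorem sub (ha : HasSymbol a f) (hb : HasSymbol b g) : HasSymbol (a - b) (f - g) := by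
  intro x
  have h := (ha x).sub (hb x)
  rw [sub_zero] at h
  refine h.congr fun n => ?_
  simp only [ContinuousMap.sub_apply, _root_.sub_apply, sub_smul]
  abel

theorem mul (ha : HasSymbol a f) (hb : HasSymbol b g) : HasSymbol (a * b) (f * g) := by
  intro x
  have h := ((a.continuous.tendsto 0).comp (hb x)).add ((ha x).const_smul (g x))
  rw [map_zero, smul_zero, add_zero] at h
  refine h.congr fun n => ?_
  simp only [Function.comp_apply, map_sub, map_smul, ContinuousMap.mul_apply, mul_apply_eq_comp,
    smul_sub, smul_smul, mul_comm (g x)]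
  abel

theorem norm_le (ha : HasSymbol a f) : ‖f‖ ≤ ‖a‖ := by
  refine (ContinuousMap.norm_le _ (norm_nonneg a)).2 fun x => ?_
  have h := (ha x).norm.const_add ‖a‖
  rw [norm_zero, add_zero] at h
  refine ge_of_tendsto' h fun n => ?_
  have hv := norm_approxEigenvector (norm_fourier_one_apply x) n
  calc ‖f x‖ = ‖f x • approxEigenvector (fourier 1 x) n‖ := by rw [norm_smul, hv, mul_one]
    _ ≤ ‖a (approxEigenvector (fourier 1 x) n)‖ + _ := norm_le_norm_add_norm_sub' _ _
    _ ≤ ‖a‖ + _ := by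
      gcongr
      exact a.unit_le_opNorm _ hv.le
    _ = _ := by rw [norm_sub_rev]

theorem unique (ha : HasSymbol a f) (hb : HasSymbol a g) : f = g := by
  have h := (ha.sub hb).norm_le
  rwa [sub_self, norm_zero, norm_le_zero_iff, sub_eq_zero] at h

theorem of_tendsto {a : ℕ → H1 →L[ℂ] H1} {f : ℕ → C(UnitAddCircle, ℂ)} {a₀ : H1 →L[ℂ] H1}
    {f₀ : C(UnitAddCircle, ℂ)} (h : ∀ k, HasSymbol (a k) (f k)) (ha : Tendsto a atTop (𝓝 a₀))
    (hf : Tendsto f atTop (𝓝 f₀)) : HasSymbol a₀ f₀ := by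
  intro x
  rw [Metric.tendsto_nhds]
  intro ε hε
  obtain ⟨k, hk, hk'⟩ := ((Metric.tendsto_nhds.1 ha (ε / 3) (by positivity)).and
    (Metric.tendsto_nhds.1 hf (ε / 3) (by positivity))).exists
  filter_upwards [Metric.tendsto_nhds.1 (h k x) (ε / 3) (by positivity)] with n hn
  rw [dist_zero_right] at hn ⊢
  rw [dist_eq_norm] at hk hk'
  set v := approxEigenvector (fourier 1 x) n
  have hv : ‖v‖ = 1 := norm_approxEigenvector (norm_fourier_one_apply x) n
  have h₁ : ‖(a k - a₀) v‖ ≤ ‖a k - a₀‖ := (a k - a₀).unit_le_opNorm _ hv.le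
  have h₂ : ‖(f k - f₀) x • v‖ ≤ ‖f k - f₀‖ := by
    rw [norm_smul, hv, mul_one]
    exact (f k - f₀).norm_coe_le_norm x
  calc ‖a₀ v - f₀ x • v‖ = ‖(a k v - f k x • v) - (a k - a₀) v + (f k - f₀) x • v‖ := by
        rw [_root_.sub_apply, ContinuousMap.sub_apply, sub_smul]
        congr 1
        abel
    _ ≤ ‖a k v - f k x • v‖ + ‖(a k - a₀) v‖ + ‖(f k - f₀) x • v‖ :=
        (norm_add_le _ _).trans (by gcongr; exact norm_sub_le _ _)
    _ < ε := by linarith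

end HasSymbol

theorem IsShift1.exists_hasSymbol (hS : IsShift1 S) {a : H1 →L[ℂ] H1} (ha : a ∈ Toeplitz1) :
    ∃ f, HasSymbol a f := by
  rw [mem_toeplitz1_iff, mem_closure_iff_seq_limit] at ha
  obtain ⟨b, hb, hba⟩ := ha
  have h (k : ℕ) : ∃ f, HasSymbol (b k) f :=
    hS.adjoin_induction (p := fun a => ∃ f, HasSymbol a f) ⟨_, .shift hS⟩ ⟨_, .star_shift hS⟩
      (fun c => ⟨_, .algebraMap c⟩) (fun _ _ ⟨_, h⟩ ⟨_, h'⟩ => ⟨_, h.add h'⟩)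
      (fun _ _ ⟨_, h⟩ ⟨_, h'⟩ => ⟨_, h.mul h'⟩) (hb k)
  choose f hf using h
  have hcauchy : CauchySeq f := by
    refine Metric.cauchySeq_iff.2 fun ε hε => ?_
    obtain ⟨N, hN⟩ := Metric.cauchySeq_iff.1 hba.cauchySeq ε hε
    refine ⟨N, fun m hm n hn => lt_of_le_of_lt ?_ (hN m hm n hn)⟩
    rw [dist_eq_norm, dist_eq_norm]
    exact ((hf m).sub (hf n)).norm_le
  obtain ⟨f₀, hf₀⟩ := cauchySeq_tendsto_of_complete hcauchy
  exact ⟨f₀, .of_tendsto hf hba hf₀⟩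

end Symbol

section Model

open Filter Topology Polynomial

variable {S : H1 →L[ℂ] H1}

namespace IsShift1

/-- The symbol homomorphism of the Toeplitz algebra. -/
def symbol (hS : IsShift1 S) : Toeplitz1 →ₐ[ℂ] C(UnitAddCircle, ℂ) where
  toFun a := (hS.exists_hasSymbol a.2).choose
  map_one' := (hS.exists_hasSymbol (Subtype.property _)).choose_spec.unique <| by
    simpa using HasSymbol.algebraMap 1
  map_mul' a b := (hS.exists_hasSymbol (Subtype.property _)).choose_spec.unique <|
    (hS.exists_hasSymbol a.2).choose_spec.mul (hS.exists_hasSymbol b.2).choose_spec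
  map_zero' := (hS.exists_hasSymbol (Subtype.property _)).choose_spec.unique <| by
    simpa using HasSymbol.algebraMap 0
  map_add' a b := (hS.exists_hasSymbol (Subtype.property _)).choose_spec.unique <|
    (hS.exists_hasSymbol a.2).choose_spec.add (hS.exists_hasSymbol b.2).choose_spec
  commutes' c := (hS.exists_hasSymbol (Subtype.property _)).choose_spec.unique <| HasSymbol.algebraMap c

theorem hasSymbol_symbol (hS : IsShift1 S) (a : Toeplitz1) : HasSymbol a (hS.symbol a) :=
  (hS.exists_hasSymbol a.2).choose_spec

theorem symbol_eq (hS : IsShift1 S) {a : Toeplitz1} {f : C(UnitAddCircle, ℂ)}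
    (h : HasSymbol a f) : hS.symbol a = f :=
  (hS.hasSymbol_symbol a).unique h

theorem norm_symbol_le (hS : IsShift1 S) (a : Toeplitz1) : ‖hS.symbol a‖ ≤ ‖a‖ :=
  (hS.hasSymbol_symbol a).norm_le

theorem denseRange_symbol (hS : IsShift1 S) (hmem : S ∈ Toeplitz1) : DenseRange hS.symbol := by
  have hs : hS.symbol ⟨S, hmem⟩ = fourier 1 := hS.symbol_eq (.shift hS)
  have ht : hS.symbol (star ⟨S, hmem⟩) = fourier (-1) := hS.symbol_eq (.star_shift hS)
  have hpow (k : ℤ) (n : ℕ) : (fourier k : C(UnitAddCircle, ℂ)) ^ n = fourier (n * k) := by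
    ext x
    induction n with
    | zero => simp
    | succ n ih =>
      rw [pow_succ, ContinuousMap.mul_apply, ih, ← fourier_add]
      push_cast
      rw [add_mul, one_mul]
  have hle : Submodule.span ℂ (Set.range (fourier (T := 1))) ≤
      LinearMap.range hS.symbol.toLinearMap := by
    rw [Submodule.span_le]
    rintro _ ⟨n, rfl⟩
    obtain ⟨n, rfl | rfl⟩ := n.eq_nat_or_neg
    · exact ⟨⟨S, hmem⟩ ^ n, by simp [-SubmonoidClass.mk_pow, hs, hpow]⟩
    · exact ⟨star ⟨S, hmem⟩ ^ n, by simp [ht, hpow]⟩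
  intro f
  have hf : f ∈ (Submodule.span ℂ (Set.range (fourier (T := 1)))).topologicalClosure := by
    rw [span_fourier_closure_eq_top]
    trivial
  exact closure_mono hle hf

theorem norm_aeval_le (hS : IsShift1 S) (p : ℂ[X]) :
    ‖aeval S p‖ ≤ ‖aeval (fourier 1 : C(UnitAddCircle, ℂ)) p‖ := by
  refine norm_aeval_le_of_isometry hS.star_mul_self p (norm_nonneg _) fun z hz => ?_
  obtain ⟨x, hx⟩ := (AddCircle.homeomorphCircle one_ne_zero).surjective
    ⟨z, mem_sphere_zero_iff_norm.2 hz⟩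
  have hz' : z = fourier (T := 1) 1 x := by
    rw [fourier_one, ← AddCircle.homeomorphCircle_apply one_ne_zero, hx]
  have h : p.eval z = aeval (fourier 1 : C(UnitAddCircle, ℂ)) p x := by
    have h₁ := aeval_algHom_apply (ContinuousMap.evalAlgHom ℂ ℂ x)
      (fourier 1 : C(UnitAddCircle, ℂ)) p
    rw [← coe_aeval_eq_eval, hz']
    exact h₁
  rw [h]
  exact ContinuousMap.norm_coe_le_norm _ x

theorem norm_mul_pow_anti (hS : IsShift1 S) (a : H1 →L[ℂ] H1) {m n : ℕ} (h : m ≤ n) :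
    ‖a * S ^ n‖ ≤ ‖a * S ^ m‖ := by
  obtain ⟨k, rfl⟩ := Nat.exists_eq_add_of_le h
  rw [pow_add, ← mul_assoc]
  calc _ ≤ ‖a * S ^ m‖ * ‖S ^ k‖ := norm_mul_le _ _
    _ ≤ ‖a * S ^ m‖ := mul_le_of_le_one_right (norm_nonneg _) (hS.norm_pow_le k)

theorem eventually_norm_mul_pow_le (hS : IsShift1 S) (hmem : S ∈ Toeplitz1) (a : Toeplitz1)
    (ha : a.1 ∈ StarAlgebra.adjoin ℂ {T : H1 →L[ℂ] H1 | IsShift1 T}) :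
    ∀ᶠ n : ℕ in atTop, ‖a.1 * S ^ n‖ ≤ ‖hS.symbol a‖ := by
  obtain ⟨n, p, hp⟩ := hS.exists_mul_pow_eq_aeval ha
  have hs : hS.symbol ⟨S, hmem⟩ = fourier 1 := hS.symbol_eq (.shift hS)
  have hp' : a * (⟨S, hmem⟩ : Toeplitz1) ^ n = aeval (⟨S, hmem⟩ : Toeplitz1) p := by
    apply Subtype.ext
    have := aeval_algHom_apply Toeplitz1.subtype.toAlgHom (⟨S, hmem⟩ : Toeplitz1) p
    exact hp.trans this
  have hsym : hS.symbol a * (fourier 1) ^ n = aeval (fourier 1) p := by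
    rw [← hs, ← map_pow, ← map_mul, hp', aeval_algHom_apply]
  have hnorm : ‖aeval (fourier 1 : C(UnitAddCircle, ℂ)) p‖ ≤ ‖hS.symbol a‖ := by
    rw [← hsym]
    refine (ContinuousMap.norm_le _ (norm_nonneg _)).2 fun x => ?_
    rw [ContinuousMap.mul_apply, ContinuousMap.pow_apply, norm_mul, norm_pow,
      norm_fourier_one_apply, one_pow, mul_one]
    exact (hS.symbol a).norm_coe_le_norm x
  filter_upwards [eventually_ge_atTop n] with m hm
  calc ‖a.1 * S ^ m‖ ≤ ‖a.1 * S ^ n‖ := hS.norm_mul_pow_anti _ hm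
    _ ≤ _ := by
      rw [hp]
      exact (hS.norm_aeval_le p).trans hnorm

theorem eventually_norm_mul_pow_lt (hS : IsShift1 S) (hmem : S ∈ Toeplitz1) (a : Toeplitz1)
    {C : ℝ} (hC : ‖hS.symbol a‖ < C) :
    ∀ᶠ n : ℕ in atTop, ‖a.1 * S ^ n‖ < C := by
  have ha := Metric.mem_closure_iff.1 (mem_toeplitz1_iff.1 a.2)
  obtain ⟨b, hb, hab⟩ := ha ((C - ‖hS.symbol a‖) / 2) (by linarith)
  rw [dist_eq_norm] at hab
  let b' : Toeplitz1 := ⟨b, StarSubalgebra.le_topologicalClosure _ hb⟩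
  have hsym : ‖hS.symbol b'‖ ≤ ‖hS.symbol a‖ + ‖a.1 - b‖ := by
    have h := (norm_le_norm_add_norm_sub (hS.symbol a) (hS.symbol b'))
    rw [← map_sub] at h
    exact h.trans (by gcongr; exact hS.norm_symbol_le (a - b'))
  filter_upwards [hS.eventually_norm_mul_pow_le hmem b' hb] with n hn
  have h₁ : ‖(a.1 - b) * S ^ n‖ ≤ ‖a.1 - b‖ := by
    simpa using hS.norm_mul_pow_anti (a.1 - b) (Nat.zero_le n)
  calc ‖a.1 * S ^ n‖ = ‖(a.1 - b) * S ^ n + b * S ^ n‖ := by rw [sub_mul, sub_add_cancel]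
    _ ≤ ‖(a.1 - b) * S ^ n‖ + ‖b * S ^ n‖ := norm_add_le _ _
    _ ≤ ‖a.1 - b‖ + (‖hS.symbol a‖ + ‖a.1 - b‖) := add_le_add h₁ (hn.trans hsym)
    _ < C := by linarith

/-- The Toeplitz algebra as a Toeplitz model. -/
def toeplitzModel (hS : IsShift1 S) (hmem : S ∈ Toeplitz1) : ToeplitzModel Toeplitz1 where
  s := ⟨S, hmem⟩
  t := star ⟨S, hmem⟩
  t_mul_s := Subtype.ext hS.star_mul_self
  norm_t_pow_le n := hS.norm_star_pow_le n
  coeff :=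
    { toFun a := a.1 (delta1 0) 0
      map_add' _ _ := rfl
      map_smul' _ _ := rfl }
  corner a := Subtype.ext (hS.corner a.1)
  coeff_one_sub := by
    change (1 - S * star S) (delta1 0) 0 = 1
    rw [hS.one_sub_apply]
    change delta1 0 0 * delta1 0 0 = (1 : ℂ)
    simp [delta1_apply]
  symbol := hS.symbol
  denseRange_symbol := hS.denseRange_symbol hmem
  eventually_norm_lt a _ hC := hS.eventually_norm_mul_pow_lt hmem a hC

end IsShift1

theorem completeSpace_toeplitz1 : CompleteSpace Toeplitz1 :=
  (StarSubalgebra.isClosed_topologicalClosure _).completeSpace_coe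

end Model

theorem stmt3 (Sop : H1 →L[ℂ] H1) (hS : IsShift1 Sop) (hmem : Sop ∈ Toeplitz1)
    (q : ↥Toeplitz1)
    (hq : q = 1 - (⟨Sop, hmem⟩ : Toeplitz1) * star (⟨Sop, hmem⟩ : Toeplitz1)) :
    (∀ (k : ℕ) (P : Matrix (Fin k) (Fin k) ↥Toeplitz1), P * P = P →
        ∃! c : ℕ ⊕ ℕ, IdemEquiv P (canonMat q c)) ∧
      ∀ c c' : ℕ ⊕ ℕ, c ≠ c' → ¬ IdemEquiv (canonMat q c) (canonMat q c') := by
  subst hq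
  have : CompleteSpace Toeplitz1 := completeSpace_toeplitz1
  exact ⟨fun _ _ hP => (hS.toeplitzModel hmem).existsUnique_idemEquiv_canonMat hP,
    fun _ _ h => (hS.toeplitzModel hmem).not_idemEquiv_canonMat h⟩
end
end
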